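/- Let b, c, K, s₁, s₂, s₃ be complex constants with c ≠ 0, and let u be a transcendental (non-rational) meromorphic solution of (E). Then the Nevanlinna proximity function of u is small compared with its characteristic: m(r,u) = o(T(r,u)) as r → ∞ outside a possible exceptional set of r of finite Lebesgue measure; equivalently, N(r,u)/T(r,u) → 1 as r → ∞ outside such an exceptional set. -/

import Mathlib

open Complex Filter Topology Asymptotics MeasureTheory

noncomputable section

/-- `u` has a pole at `z₀`: `‖u z‖ → ∞` as `z → z₀`, `z ≠ z₀`. -/
def IsPoleAt (u : ℂ → ℂ) (z₀ : ℂ) : Prop :=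
  Tendsto (fun z => ‖u z‖) (𝓝[≠] z₀) atTop

/-- `u` is meromorphic on all of `ℂ`: at every point it is either analytic or has a pole. -/
def MeromorphicOnPlane (u : ℂ → ℂ) : Prop :=
  ∀ z : ℂ, AnalyticAt ℂ u z ∨ IsPoleAt u z

/-- Equation (E) at the point `z`. -/
def SatisfiesE (b c K s₁ s₂ s₃ : ℂ) (u : ℂ → ℂ) (z : ℂ) : Prop :=
  deriv u z * iteratedDeriv 3 u z - (1/2) * (iteratedDeriv 2 u z)^2
    + 30 * b * (deriv u z)^2
    - (30 / c^2) * ((u z)^4 - 4*s₁*(u z)^3 + 6*s₂*(u z)^2 - 4*s₃*(u z)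
        + 3*s₁^4 - 6*s₁^2*s₂ + 4*s₁*s₃) = K

/-- A meromorphic solution of (E). -/
def IsMeromorphicSolution (b c K s₁ s₂ s₃ : ℂ) (u : ℂ → ℂ) : Prop :=
  MeromorphicOnPlane u ∧ ∀ z : ℂ, AnalyticAt ℂ u z → SatisfiesE b c K s₁ s₂ s₃ u z

/-- `u` is a rational function of `z`. -/
def IsRationalFunction (u : ℂ → ℂ) : Prop :=
  ∃ p q : Polynomial ℂ, q ≠ 0 ∧
    ∀ z : ℂ, AnalyticAt ℂ u z → Polynomial.eval z q ≠ 0 →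
      u z = Polynomial.eval z p / Polynomial.eval z q

/-- The multiplicity (order) of a pole of `u` at `p`: the least `n` such that
`(z−p)ⁿ u(z)` has a finite limit as `z → p`. -/
def poleOrderAt (u : ℂ → ℂ) (p : ℂ) : ℕ :=
  sInf {n : ℕ | ∃ α : ℂ, Tendsto (fun z => (z - p)^n * u z) (𝓝[≠] p) (𝓝 α)}

/-- Unintegrated counting function `n(r,u)`: number of poles of `u` in the closed disc
of radius `r`, counted with multiplicity. -/
def unintegratedCounting (u : ℂ → ℂ) (r : ℝ) : ℝ :=
  ∑' p : {p : ℂ | IsPoleAt u p ∧ ‖p‖ ≤ r}, (poleOrderAt u (p : ℂ) : ℝ)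

/-- Integrated counting function
`N(r,u) = n(0,u) log r + ∫₀ʳ [n(t,u) − n(0,u)] dt/t`. -/
def integratedCounting (u : ℂ → ℂ) (r : ℝ) : ℝ :=
  unintegratedCounting u 0 * Real.log r +
    ∫ t in (0:ℝ)..r, (unintegratedCounting u t - unintegratedCounting u 0) / t

/-- Proximity function `m(r,u) = ∫₀^{2π} log⁺ |u(r e^{iθ})| dθ/(2π)`. -/
def proximityFn (u : ℂ → ℂ) (r : ℝ) : ℝ :=
  (1 / (2 * Real.pi)) *
    ∫ θ in (0:ℝ)..(2 * Real.pi), max 0 (Real.log ‖u ((r : ℂ) * Complex.exp (θ * Complex.I))‖)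

/-- Nevanlinna characteristic `T(r,u) = m(r,u) + N(r,u)`. -/
def characteristicFn (u : ℂ → ℂ) (r : ℝ) : ℝ :=
  proximityFn u r + integratedCounting u r

/-- **Borel's growth lemma**: a function that is monotone and at least `1` on `[r₀, ∞)` satisfies
`T (r + 1 / T r) < 2 * T r` outside a set of finite measure. -/
theorem volume_borel_exceptional_lt_top {T : ℝ → ℝ} {r₀ : ℝ} (hT : MonotoneOn T (Set.Ici r₀))
    (h1 : ∀ r, r₀ ≤ r → 1 ≤ T r) :
    volume {r : ℝ | r₀ ≤ r ∧ 2 * T r ≤ T (r + 1 / T r)} < ⊤ := by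
  set S : ℕ → Set ℝ := fun k =>
    {r : ℝ | (r₀ ≤ r ∧ 2 * T r ≤ T (r + 1 / T r)) ∧ (2:ℝ) ^ k ≤ T r ∧ T r < 2 ^ (k + 1)} with hS
  have hsub : {r : ℝ | r₀ ≤ r ∧ 2 * T r ≤ T (r + 1 / T r)} ⊆ ⋃ k, S k := by
    intro r hr
    obtain ⟨n, hn1, hn2⟩ := exists_nat_pow_near (h1 r hr.1) (by norm_num : (1:ℝ) < 2)
    exact Set.mem_iUnion.2 ⟨n, hr, hn1, hn2⟩
  have key : ∀ k, ∀ r ∈ S k, ∀ s ∈ S k, s - r ≤ (1 / 2 : ℝ) ^ k := by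
    rintro k r ⟨⟨hr0, hr⟩, hr1, hr2⟩ s ⟨⟨hs0, hs⟩, hs1, hs2⟩
    by_contra! hlt
    have hTr : 0 < T r := by linarith [h1 r hr0]
    have h2 : 1 / T r ≤ (1 / 2 : ℝ) ^ k := by
      rw [one_div_pow]
      exact one_div_le_one_div_of_le (by positivity) hr1
    have h3 : T (r + 1 / T r) ≤ T s := by
      apply hT
      · exact Set.mem_Ici.2 (by have : 0 < 1 / T r := by positivity
                                linarith)
      · exact hs0
      · linarith
    rw [pow_succ] at hs2
    linarith
  have hvol : ∀ k, volume (S k) ≤ (ENNReal.ofReal (1 / 2)) ^ k := by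
    intro k
    refine (Real.volume_le_diam _).trans ?_
    refine Metric.ediam_le fun x hx y hy => ?_
    rw [edist_dist, ← ENNReal.ofReal_pow (by norm_num)]
    apply ENNReal.ofReal_le_ofReal
    rw [Real.dist_eq, abs_le]
    constructor <;> linarith [key k x hx y hy, key k y hy x hx]
  calc volume _ ≤ volume (⋃ k, S k) := measure_mono hsub
    _ ≤ ∑' k, volume (S k) := measure_iUnion_le _
    _ ≤ ∑' k, (ENNReal.ofReal (1 / 2)) ^ k := ENNReal.tsum_le_tsum hvol
    _ < ⊤ := by
      rw [ENNReal.tsum_geometric, ENNReal.inv_lt_top]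
      simp

/-- The radii within `1 / n(‖a‖) ^ 2` of `‖a‖` for some `a` in a locally finite set, where `n`
counts the points of the set in a closed ball, form a set of finite measure. -/
theorem volume_near_norms_lt_top {S : Set ℂ} (hS : ∀ r : ℝ, (S ∩ Metric.closedBall 0 r).Finite) :
    volume (⋃ a ∈ S, Metric.ball ‖a‖ (1 / ((S ∩ Metric.closedBall 0 ‖a‖).ncard : ℝ) ^ 2)) < ⊤ := by
  set n : ℝ → ℕ := fun t => (S ∩ Metric.closedBall 0 t).ncard with hn
  set M : Set ℝ := (fun a : ℂ => ‖a‖) '' S with hM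
  have hinj : Function.Injective (fun t : M => n t) := by
    have hlt : ∀ s t : M, (s : ℝ) < t → n s < n t := by
      rintro s ⟨_, a, ha, rfl⟩ h
      apply Set.ncard_lt_ncard _ (hS _)
      refine ⟨Set.inter_subset_inter_right _ (Metric.closedBall_subset_closedBall h.le), ?_⟩
      intro hsub
      have := (hsub ⟨ha, by simp⟩).2
      simp only [Metric.mem_closedBall, dist_zero_right] at this
      exact absurd h (not_lt.2 this)
    intro s t hst
    rcases lt_trichotomy (s : ℝ) t with h | h | h
    · exact absurd hst (hlt _ _ h).ne
    · exact Subtype.ext h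
    · exact absurd hst (hlt _ _ h).ne'
  have hcount : S.Countable := by
    have : S = ⋃ k : ℕ, S ∩ Metric.closedBall 0 (k : ℝ) := by
      rw [← Set.inter_iUnion, Metric.iUnion_closedBall_nat, Set.inter_univ]
    rw [this]
    exact Set.countable_iUnion fun k => (hS k).countable
  have hMc : Countable M := (hcount.image _).to_subtype
  have hEq : (⋃ a ∈ S, Metric.ball ‖a‖ (1 / ((S ∩ Metric.closedBall 0 ‖a‖).ncard : ℝ) ^ 2))
      ⊆ ⋃ t : M, Metric.ball (t : ℝ) (1 / (n t : ℝ) ^ 2) := by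
    intro x hx
    obtain ⟨a, ha, hxa⟩ := Set.mem_iUnion₂.1 hx
    exact Set.mem_iUnion.2 ⟨⟨‖a‖, a, ha, rfl⟩, hxa⟩
  have hsum : Summable (fun k : ℕ => 2 * (1 / (k : ℝ) ^ 2)) :=
    (Real.summable_one_div_nat_pow.2 (by norm_num)).mul_left 2
  calc volume _ ≤ volume (⋃ t : M, Metric.ball (t : ℝ) (1 / (n t : ℝ) ^ 2)) := measure_mono hEq
    _ ≤ ∑' t : M, volume (Metric.ball (t : ℝ) (1 / (n t : ℝ) ^ 2)) := measure_iUnion_le _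
    _ = ∑' t : M, ENNReal.ofReal (2 * (1 / (n t : ℝ) ^ 2)) := by simp only [Real.volume_ball]
    _ ≤ ∑' k : ℕ, ENNReal.ofReal (2 * (1 / (k : ℝ) ^ 2)) :=
      ENNReal.tsum_comp_le_tsum_of_injective hinj (fun k => ENNReal.ofReal (2 * (1 / (k : ℝ) ^ 2)))
    _ < ⊤ := hsum.tsum_ofReal_lt_top

/-- A zero-free function on a disc with bounded logarithmic modulus has a holomorphic logarithm
there whose derivatives at the centre satisfy Cauchy-type bounds. -/
theorem exists_local_log {f : ℂ → ℂ} {z : ℂ} {η B : ℝ} (hη : 0 < η)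
    (hf : DifferentiableOn ℂ f (Metric.ball z η)) (hne : ∀ w ∈ Metric.ball z η, f w ≠ 0)
    (hB : 0 < B) (hb : ∀ w ∈ Metric.ball z η, |Real.log ‖f w‖| ≤ B) :
    ∃ l : ℂ → ℂ, DifferentiableOn ℂ l (Metric.ball z η) ∧ l z = 0 ∧
      (∀ w ∈ Metric.ball z η, f w = f z * Complex.exp (l w)) ∧
      ∀ k : ℕ, ‖iteratedDeriv k l z‖ ≤ (k.factorial : ℝ) * (4 * B) / (η / 2) ^ k := by
  have hzb : z ∈ Metric.ball z η := Metric.mem_ball_self hη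
  have hd : DifferentiableOn ℂ (fun w => deriv f w / f w) (Metric.ball z η) :=
    (hf.deriv Metric.isOpen_ball).div hf hne
  obtain ⟨l, hl0, hl⟩ := (DifferentiableOn.isExactOn_ball hd).with_val_at z 0
  have hld : DifferentiableOn ℂ l (Metric.ball z η) := fun w hw =>
    (hl w hw).differentiableAt.differentiableWithinAt
  have hexp : ∀ w ∈ Metric.ball z η, f w = f z * Complex.exp (l w) := by
    intro w hw
    have hder : ∀ x ∈ Metric.ball z η,
        HasDerivAt (fun y => f y * Complex.exp (-l y)) 0 x := by
      intro x hx
      have h1 : HasDerivAt f (deriv f x) x :=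
        (hf.differentiableAt (Metric.isOpen_ball.mem_nhds hx)).hasDerivAt
      have h2 := h1.mul ((hl x hx).neg.cexp)
      have h3 : deriv f x * Complex.exp (-l x) +
          f x * (Complex.exp (-l x) * -(deriv f x / f x)) = 0 := by
        have := hne x hx
        field_simp
        ring
      exact h3 ▸ h2
    have hconst : f w * Complex.exp (-l w) = f z * Complex.exp (-l z) := by
      refine (convex_ball z η).is_const_of_fderivWithin_eq_zero (𝕜 := ℂ)
        (f := fun y => f y * Complex.exp (-l y)) (fun x hx =>
          (hder x hx).differentiableAt.differentiableWithinAt) (fun x hx => ?_) hw hzb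
      rw [fderivWithin_of_isOpen Metric.isOpen_ball hx]
      ext
      simp [(hder x hx).deriv]
    rw [hl0, neg_zero, Complex.exp_zero, mul_one] at hconst
    rw [← hconst, mul_assoc, ← Complex.exp_add]
    simp
  refine ⟨l, hld, hl0, hexp, fun k => ?_⟩
  have hre : ∀ w ∈ Metric.ball z η, (l w).re ≤ 2 * B := by
    intro w hw
    have h1 : Real.log ‖f w‖ = Real.log ‖f z‖ + (l w).re := by
      rw [hexp w hw, norm_mul, Complex.norm_exp,
        Real.log_mul (norm_ne_zero_iff.2 (hne z hzb)) (Real.exp_pos _).ne', Real.log_exp]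
    have h2 := abs_le.1 (hb w hw)
    have h3 := abs_le.1 (hb z hzb)
    linarith [h2.2, h3.1]
  have hsub : Metric.closedBall z (η / 2) ⊆ Metric.ball z η :=
    Metric.closedBall_subset_ball (by linarith)
  refine Complex.norm_iteratedDeriv_le_of_forall_mem_sphere_norm_le k (by positivity)
    (hld.diffContOnCl_ball hsub) fun w hw => ?_
  have hmem : ∀ x ∈ Metric.ball (0 : ℂ) η, z + x ∈ Metric.ball z η := by
    intro x hx
    simpa [Metric.mem_ball, dist_eq_norm] using hx
  have hnw : ‖w - z‖ = η / 2 := by simpa [dist_eq_norm] using hw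
  have key := Complex.borelCaratheodory_zero (f := fun x => l (z + x)) (M := 2 * B) (R := η)
    (z := w - z) (by positivity)
    (hld.comp (by fun_prop) hmem) (fun x hx => hre _ (hmem x hx)) hη
    (by simp [hnw]; linarith) (by simpa using hl0)
  simp only [add_sub_cancel, hnw] at key
  refine key.trans (le_of_eq ?_)
  field_simp
  ring

/-- **Harnack-type estimate** for `log ‖g‖` with `g` analytic and zero-free on a closed disc. -/
theorem abs_log_norm_le_mul_circleAverage {g : ℂ → ℂ} {R : ℝ} {w : ℂ}
    (hg : AnalyticOnNhd ℂ g (Metric.closedBall 0 R)) (hne : ∀ z ∈ Metric.closedBall 0 R, g z ≠ 0)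
    (hw : ‖w‖ < R) :
    |Real.log ‖g w‖| ≤ (R + ‖w‖) / (R - ‖w‖) *
      Real.circleAverage (fun z => |Real.log ‖g z‖|) 0 R := by
  have hR : 0 < R := (norm_nonneg w).trans_lt hw
  have hwb : w ∈ Metric.ball (0 : ℂ) R := by simpa using hw
  have hharm : InnerProductSpace.HarmonicOnNhd (fun z => Real.log ‖g z‖) (Metric.closedBall 0 R) :=
    fun z hz => (hg z hz).harmonicAt_log_norm (hne z hz)
  have hcont : ContinuousOn (fun z => Real.log ‖g z‖) (Metric.sphere 0 |R|) := by
    rw [abs_of_pos hR]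
    exact hharm.continuousOn.mono Metric.sphere_subset_closedBall
  have hker : ContinuousOn (fun z => (herglotzRieszKernel 0 w z).re) (Metric.sphere 0 |R|) :=
    Complex.continuous_re.comp_continuousOn (continuousOn_herglotzRieszKernel_sphere hwb)
  have key := hharm.circleAverage_re_herglotzRieszKernel_smul hwb
  rw [← key]
  refine Real.abs_circleAverage_le_circleAverage_abs.trans ?_
  rw [← smul_eq_mul, ← Real.circleAverage_fun_smul]
  refine Real.circleAverage_mono ?_ ?_ fun z hz => ?_
  · exact ((hker.mul hcont).abs).circleIntegrable'
  · exact (continuousOn_const.mul hcont.abs).circleIntegrable'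
  · rw [abs_of_pos hR] at hz
    have h1 := re_herglotzRieszKernel_le hz hwb
    have h2 := le_re_herglotzRieszKernel hz hwb
    simp only [sub_zero] at h1 h2
    have h3 : 0 ≤ (R - ‖w‖) / (R + ‖w‖) := div_nonneg (by linarith) (by positivity)
    have h4 : herglotzRieszKernel 0 w z = (z + w) / (z - w) := by
      simp [herglotzRieszKernel_def]
    rw [← h4] at h1 h2
    change |(herglotzRieszKernel 0 w z).re * Real.log ‖g z‖| ≤ _ * |Real.log ‖g z‖|
    rw [abs_mul, abs_of_nonneg (h3.trans h2)]
    gcongr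

/-- Functions that agree off a discrete subset of a neighbourhood of `w` agree at `w` if both are
continuous there. -/
theorem eq_of_eventuallyEq_codiscreteWithin {f h : ℂ → ℂ} {U : Set ℂ} {w : ℂ}
    (hfh : f =ᶠ[codiscreteWithin U] h) (hU : U ∈ 𝓝 w) (hf : ContinuousAt f w)
    (hh : ContinuousAt h w) : f w = h w := by
  have h1 := mem_codiscreteWithin.1 hfh w (mem_of_mem_nhds hU)
  have h2 : ∀ᶠ z in 𝓝[≠] w, f z = h z := by
    rw [Filter.disjoint_principal_right] at h1
    filter_upwards [h1, nhdsWithin_le_nhds hU] with z hz hzU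
    by_contra hne
    exact hz ⟨hzU, hne⟩
  exact ((hf.eventuallyEq_nhds_iff_eventuallyEq_nhdsNE hh).1 h2).eq_of_nhds

/-- The finite set of zeros and poles of `u` in the closed disc of radius `R`. -/
def zeroPoleSet (u : ℂ → ℂ) (R : ℝ) : Finset ℂ :=
  ((MeromorphicOn.divisor u (Metric.closedBall 0 R)).finiteSupport
    (isCompact_closedBall 0 R)).toFinset

/-- The number of zeros and poles of `u` in the closed disc of radius `R`, with multiplicity. -/
def zeroPoleCount (u : ℂ → ℂ) (R : ℝ) : ℝ :=
  ∑ a ∈ zeroPoleSet u R, |(MeromorphicOn.divisor u Set.univ a : ℝ)|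

theorem mem_zeroPoleSet {u : ℂ → ℂ} (hu : Meromorphic u) {R : ℝ} {a : ℂ} :
    a ∈ zeroPoleSet u R ↔ ‖a‖ ≤ R ∧ MeromorphicOn.divisor u Set.univ a ≠ 0 := by
  have hm : ∀ U : Set ℂ, MeromorphicOn u U := fun U => hu.meromorphicOn
  by_cases ha : a ∈ Metric.closedBall (0 : ℂ) R
  · have ha' : ‖a‖ ≤ R := by simpa using ha
    simp [zeroPoleSet, MeromorphicOn.divisor_apply (hm _) ha,
      MeromorphicOn.divisor_apply (hm _) (Set.mem_univ a), ha']
  · have ha' : ¬ ‖a‖ ≤ R := by simpa using ha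
    simp [zeroPoleSet, Function.locallyFinsuppWithin.apply_eq_zero_of_notMem _ ha, ha']

theorem zeroPoleCount_nonneg (u : ℂ → ℂ) (R : ℝ) : 0 ≤ zeroPoleCount u R :=
  Finset.sum_nonneg fun _ _ => abs_nonneg _

theorem divisor_eq_zero_of_analyticAt {u : ℂ → ℂ} (hu : Meromorphic u) {w : ℂ}
    (hw : AnalyticAt ℂ u w) (h0 : u w ≠ 0) : MeromorphicOn.divisor u Set.univ w = 0 := by
  rw [MeromorphicOn.divisor_apply hu.meromorphicOn (Set.mem_univ w),
    hw.meromorphicOrderAt_eq, hw.analyticOrderAt_eq_zero.2 h0]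
  rfl

/-- Factorization of `u` on a closed disc into a rational part and a zero-free analytic part,
together with the resulting formulas for `log ‖u‖`. -/
theorem exists_analytic_factor {u : ℂ → ℂ} (hu : Meromorphic u)
    (htop : ∀ z, meromorphicOrderAt u z ≠ ⊤) (R : ℝ) :
    ∃ g : ℂ → ℂ, AnalyticOnNhd ℂ g (Metric.closedBall 0 R) ∧
      (∀ z ∈ Metric.closedBall 0 R, g z ≠ 0) ∧
      (fun z => Real.log ‖u z‖) =ᶠ[codiscreteWithin (Metric.closedBall 0 R)]
        (fun z => (∑ a ∈ zeroPoleSet u R,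
          (MeromorphicOn.divisor u Set.univ a : ℝ) * Real.log ‖z - a‖) + Real.log ‖g z‖) ∧
      ∀ w, ‖w‖ < R → AnalyticAt ℂ u w → u w ≠ 0 →
        Real.log ‖u w‖ = (∑ a ∈ zeroPoleSet u R,
          (MeromorphicOn.divisor u Set.univ a : ℝ) * Real.log ‖w - a‖) + Real.log ‖g w‖ := by
  set U : Set ℂ := Metric.closedBall 0 R
  have hfin := (MeromorphicOn.divisor u U).finiteSupport (isCompact_closedBall 0 R)
  obtain ⟨g, hga, hg0, hg⟩ := MeromorphicOn.extract_zeros_poles (U := U) hu.meromorphicOn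
    (fun z => htop z) hfin
  have hlog := MeromorphicOn.extract_zeros_poles_log hg0 hg
  have hD : ∀ a ∈ zeroPoleSet u R,
      MeromorphicOn.divisor u U a = MeromorphicOn.divisor u Set.univ a := by
    intro a ha
    have ha' : a ∈ U := by simpa [U] using ((mem_zeroPoleSet hu).1 ha).1
    rw [MeromorphicOn.divisor_apply hu.meromorphicOn ha',
      MeromorphicOn.divisor_apply hu.meromorphicOn (Set.mem_univ a)]
  have hsum : (∑ᶠ a, fun z : ℂ => (MeromorphicOn.divisor u U a : ℝ) * Real.log ‖z - a‖) =
      fun z => ∑ a ∈ zeroPoleSet u R,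
        (MeromorphicOn.divisor u Set.univ a : ℝ) * Real.log ‖z - a‖ := by
    rw [finsum_eq_sum_of_support_subset (s := zeroPoleSet u R)]
    · ext z
      rw [Finset.sum_apply]
      exact Finset.sum_congr rfl fun a ha => by rw [hD a ha]
    · intro a ha
      simp only [zeroPoleSet, Set.Finite.coe_toFinset, Function.mem_support]
      intro h0
      apply ha
      ext z
      simp [U, h0]
  have hlog' : (fun z => Real.log ‖u z‖) =ᶠ[codiscreteWithin U]
        (fun z => (∑ a ∈ zeroPoleSet u R,
          (MeromorphicOn.divisor u Set.univ a : ℝ) * Real.log ‖z - a‖) + Real.log ‖g z‖) := by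
    rw [hsum] at hlog
    exact hlog
  refine ⟨g, hga, fun z hz => hg0 ⟨z, hz⟩, hlog', fun w hw hua hu0 => ?_⟩
  have hwU : U ∈ 𝓝 w := Filter.mem_of_superset
    (Metric.isOpen_ball.mem_nhds (show w ∈ Metric.ball (0 : ℂ) R by simpa using hw))
    Metric.ball_subset_closedBall
  have hwmem : w ∈ U := mem_of_mem_nhds hwU
  have h1 := mem_codiscreteWithin.1 hlog' w hwmem
  have h2 : ∀ᶠ z in 𝓝[≠] w, Real.log ‖u z‖ = (∑ a ∈ zeroPoleSet u R,
          (MeromorphicOn.divisor u Set.univ a : ℝ) * Real.log ‖z - a‖) + Real.log ‖g z‖ := by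
    rw [Filter.disjoint_principal_right] at h1
    filter_upwards [h1, nhdsWithin_le_nhds hwU] with z hz hzU
    by_contra hne
    exact hz ⟨hzU, hne⟩
  have hc1 : ContinuousAt (fun z => Real.log ‖u z‖) w :=
    hua.continuousAt.norm.log (norm_ne_zero_iff.2 hu0)
  have hc2 : ContinuousAt (fun z => (∑ a ∈ zeroPoleSet u R,
      (MeromorphicOn.divisor u Set.univ a : ℝ) * Real.log ‖z - a‖) + Real.log ‖g z‖) w := by
    refine ContinuousAt.add (tendsto_finsetSum _ fun a ha => ?_)
      ((hga w hwmem).continuousAt.norm.log (norm_ne_zero_iff.2 (hg0 ⟨w, hwmem⟩)))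
    have hwa : w - a ≠ 0 := by
      rw [sub_ne_zero]
      rintro rfl
      exact ((mem_zeroPoleSet hu).1 ha).2 (divisor_eq_zero_of_analyticAt hu hua hu0)
    exact ContinuousAt.mul continuousAt_const
      ((continuousAt_id.sub continuousAt_const).norm.log (norm_ne_zero_iff.2 hwa))
  exact ((hc1.eventuallyEq_nhds_iff_eventuallyEq_nhdsNE hc2).1 h2).eq_of_nhds

/-- The mean of `|log ‖u‖|` on a circle is controlled by the characteristic. -/
theorem circleAverage_abs_log_norm_le {u : ℂ → ℂ} (hu : Meromorphic u) {R : ℝ} (hR : 1 ≤ R) :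
    Real.circleAverage (fun z => |Real.log ‖u z‖|) 0 R ≤
      2 * ValueDistribution.characteristic u ⊤ R +
        |Real.log ‖meromorphicTrailingCoeffAt u 0‖| := by
  have h1 : (fun z => |Real.log ‖u z‖|) = fun z => Real.posLog ‖u z‖ + Real.posLog ‖u⁻¹ z‖ := by
    ext z
    simp only [Pi.inv_apply, norm_inv, Real.posLog, Real.log_inv]
    rcases le_total 0 (Real.log ‖u z‖) with h | h
    · rw [abs_of_nonneg h, max_eq_right h, max_eq_left (by linarith), add_zero]
    · rw [abs_of_nonpos h, max_eq_left h, max_eq_right (by linarith), zero_add]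
  have h2 : Real.circleAverage (fun z => |Real.log ‖u z‖|) 0 R =
      ValueDistribution.proximity u ⊤ R + ValueDistribution.proximity u⁻¹ ⊤ R := by
    rw [h1, Real.circleAverage_fun_add, ValueDistribution.proximity_top,
      ValueDistribution.proximity_top]
    · exact hu.meromorphicOn.circleIntegrable_posLog_norm
    · exact hu.inv.meromorphicOn.circleIntegrable_posLog_norm
  have h3 := ValueDistribution.characteristic_sub_characteristic_inv_of_ne_zero (R := R) hu
    (by linarith)
  have h4 : 0 ≤ ValueDistribution.logCounting u ⊤ R := ValueDistribution.logCounting_nonneg hR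
  have h5 : 0 ≤ ValueDistribution.logCounting u⁻¹ ⊤ R := ValueDistribution.logCounting_nonneg hR
  have h6 : ∀ f : ℂ → ℂ, ValueDistribution.characteristic f ⊤ R =
    ValueDistribution.proximity f ⊤ R + ValueDistribution.logCounting f ⊤ R := fun f => rfl
  rw [h6 u⁻¹] at h3
  rw [h6 u] at h3 ⊢
  have h7 := neg_abs_le (Real.log ‖meromorphicTrailingCoeffAt u 0‖)
  linarith

/-- The mean of `|log ‖z - a‖|` on a circle enclosing `a`. -/
theorem circleAverage_abs_log_norm_sub_le {a : ℂ} {R : ℝ} (hR : 1 ≤ R) (ha : ‖a‖ ≤ R) :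
    Real.circleAverage (fun z => |Real.log ‖z - a‖|) 0 R ≤ 2 * Real.log (2 * R) := by
  have hint : CircleIntegrable (fun z => Real.log ‖z - a‖) 0 R :=
    MeromorphicOn.circleIntegrable_log_norm (f := fun z => z - a)
      (fun z _ => by fun_prop)
  have habs : CircleIntegrable (fun z => |Real.log ‖z - a‖|) 0 R := hint.abs
  have h1 : Real.circleAverage (fun z => |Real.log ‖z - a‖| + Real.log ‖z - a‖) 0 R ≤
      2 * Real.log (2 * R) := by
    refine Real.circleAverage_mono_on_of_le_circle (CircleIntegrable.add hint.abs hint) ?_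
    intro z hz
    rw [abs_of_nonneg (by linarith)] at hz
    have hz' : ‖z‖ = R := by simpa using hz
    have hn : ‖z - a‖ ≤ 2 * R := (norm_sub_le z a).trans (by linarith)
    have h0 : 0 ≤ Real.log (2 * R) := Real.log_nonneg (by linarith)
    rcases le_total 0 (Real.log ‖z - a‖) with h | h
    · rw [abs_of_nonneg h]
      rcases (norm_nonneg (z - a)).eq_or_lt with hpos | hpos
      · rw [← hpos, Real.log_zero]
        linarith
      · linarith [Real.log_le_log hpos hn]
    · rw [abs_of_nonpos h]
      linarith
  rw [Real.circleAverage_fun_add habs hint,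
    circleAverage_log_norm_sub_const_of_mem_closedBall
      (by simpa [abs_of_nonneg (zero_le_one.trans hR)] using ha)] at h1
  linarith [Real.log_nonneg hR]

/-- The mean of `|log ‖g‖|` for the zero-free factor of `u`. -/
theorem circleAverage_abs_log_norm_factor_le {u g : ℂ → ℂ} (hu : Meromorphic u) {R : ℝ}
    (hR : 1 ≤ R) (S : Finset ℂ) (D : ℂ → ℤ) (hS : ∀ a ∈ S, ‖a‖ ≤ R)
    (hg : (fun z => Real.log ‖u z‖) =ᶠ[codiscreteWithin (Metric.closedBall 0 R)]
        (fun z => (∑ a ∈ S, (D a : ℝ) * Real.log ‖z - a‖) + Real.log ‖g z‖)) :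
    Real.circleAverage (fun z => |Real.log ‖g z‖|) 0 R ≤
      2 * ValueDistribution.characteristic u ⊤ R +
        |Real.log ‖meromorphicTrailingCoeffAt u 0‖| +
        (∑ a ∈ S, |(D a : ℝ)|) * (2 * Real.log (2 * R)) := by
  have hR0 : 0 ≤ R := zero_le_one.trans hR
  have hsph : Metric.sphere (0 : ℂ) |R| ⊆ Metric.closedBall 0 R := by
    rw [abs_of_nonneg hR0]
    exact Metric.sphere_subset_closedBall
  have hint : ∀ a, CircleIntegrable (fun z => Real.log ‖z - a‖) 0 R := fun a =>
    MeromorphicOn.circleIntegrable_log_norm (f := fun z => z - a) (fun z _ => by fun_prop)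
  have hintu : CircleIntegrable (fun z => Real.log ‖u z‖) 0 R :=
    MeromorphicOn.circleIntegrable_log_norm hu.meromorphicOn
  have habsu : CircleIntegrable (fun z => |Real.log ‖u z‖|) 0 R := hintu.abs
  have hsumi : CircleIntegrable (fun z => ∑ a ∈ S, (D a : ℝ) * Real.log ‖z - a‖) 0 R :=
    CircleIntegrable.fun_sum S fun a _ => (hint a).const_mul _
  have habsi : ∀ a ∈ S, CircleIntegrable (fun z => |(D a : ℝ)| * |Real.log ‖z - a‖|) 0 R :=
    fun a _ => (hint a).abs.const_mul _
  have hsumi' : CircleIntegrable (fun z => ∑ a ∈ S, |(D a : ℝ)| * |Real.log ‖z - a‖|) 0 R :=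
    CircleIntegrable.fun_sum S habsi
  have h1 : Real.circleAverage (fun z => |Real.log ‖g z‖|) 0 R =
      Real.circleAverage (fun z => |Real.log ‖u z‖ -
        ∑ a ∈ S, (D a : ℝ) * Real.log ‖z - a‖|) 0 R := by
    refine Real.circleAverage_congr_codiscreteWithin ?_ (by linarith)
    filter_upwards [hg.filter_mono (Filter.codiscreteWithin_mono hsph)] with z hz
    rw [hz]
    congr 1
    ring
  rw [h1]
  have h2 : Real.circleAverage (fun z => |Real.log ‖u z‖ -
        ∑ a ∈ S, (D a : ℝ) * Real.log ‖z - a‖|) 0 R ≤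
      Real.circleAverage (fun z => |Real.log ‖u z‖| +
        ∑ a ∈ S, |(D a : ℝ)| * |Real.log ‖z - a‖|) 0 R := by
    refine Real.circleAverage_mono (hintu.sub hsumi).abs (hintu.abs.add hsumi') fun z _ => ?_
    refine (abs_sub _ _).trans (add_le_add_right ?_ _)
    refine (Finset.abs_sum_le_sum_abs _ _).trans (le_of_eq ?_)
    exact Finset.sum_congr rfl fun a _ => abs_mul _ _
  refine h2.trans ?_
  rw [Real.circleAverage_fun_add habsu hsumi',
    Real.circleAverage_fun_sum habsi, Finset.sum_mul]
  refine add_le_add (circleAverage_abs_log_norm_le hu hR) (Finset.sum_le_sum fun a ha => ?_)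
  have h3 := Real.circleAverage_fun_smul (a := |(D a : ℝ)|)
    (f := fun z => |Real.log ‖z - a‖|) (c := 0) (R := R)
  simp only [smul_eq_mul] at h3
  rw [h3]
  exact mul_le_mul_of_nonneg_left (circleAverage_abs_log_norm_sub_le hR (hS a ha)) (abs_nonneg _)

/-- The logarithmic counting function of an effective divisor bounds weighted finite sums. -/
theorem sum_mul_log_le_logCounting {D : Function.locallyFinsupp ℂ ℤ} (hD : 0 ≤ D) {R R' : ℝ}
    (hR : 1 ≤ R) (hRR : R ≤ R') (S : Finset ℂ) (hS : ∀ a ∈ S, ‖a‖ ≤ R) :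
    (∑ a ∈ S, (D a : ℝ)) * Real.log (R' / R) ≤
      Function.locallyFinsuppWithin.logCounting D R' := by
  have hR0 : 0 < R := by linarith
  have hR'0 : 0 < R' := by linarith
  have hD' : ∀ a, (0 : ℝ) ≤ D a := fun a => by exact_mod_cast hD a
  set E := Function.locallyFinsuppWithin.toClosedBall R' D with hE
  have hEin : ∀ z, ‖z‖ ≤ R' → E z = D z := fun z hz =>
    Function.locallyFinsuppWithin.toClosedBall_eval_within D
      (by simpa [abs_of_pos hR'0] using hz)
  have hEout : ∀ z, ¬ ‖z‖ ≤ R' → E z = 0 := fun z hz =>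
    Function.locallyFinsuppWithin.apply_eq_zero_of_notMem _
      (by simpa [abs_of_pos hR'0] using hz)
  have hfin : (Function.support fun z => (E z : ℝ) * Real.log (R' * ‖z‖⁻¹)).Finite := by
    refine (E.finiteSupport (isCompact_closedBall 0 |R'|)).subset fun z hz => ?_
    rw [Function.mem_support] at hz ⊢
    intro h0
    simp [h0] at hz
  have hval : Function.locallyFinsuppWithin.logCounting D R' =
      (∑ᶠ z, (E z : ℝ) * Real.log (R' * ‖z‖⁻¹)) + (D 0 : ℝ) * Real.log R' := rfl
  have hterm : ∀ z, 0 ≤ (E z : ℝ) * Real.log (R' * ‖z‖⁻¹) := by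
    intro z
    by_cases hz : ‖z‖ ≤ R'
    · rw [hEin z hz]
      refine mul_nonneg (hD' z) ?_
      rcases eq_or_ne z 0 with rfl | hz0
      · simp
      · refine Real.log_nonneg ?_
        rw [← div_eq_mul_inv, one_le_div (norm_pos_iff.2 hz0)]
        exact hz
    · simp [hEout z hz]
  have hsum : ∑ a ∈ S, (E a : ℝ) * Real.log (R' * ‖a‖⁻¹) ≤
      ∑ᶠ z, (E z : ℝ) * Real.log (R' * ‖z‖⁻¹) := by
    rw [finsum_eq_sum_of_support_subset (s := hfin.toFinset ∪ S) _ (by simp)]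
    exact Finset.sum_le_sum_of_subset_of_nonneg Finset.subset_union_right fun i _ _ => hterm i
  have hlog : Real.log (R' / R) ≤ Real.log R' :=
    Real.log_le_log (by positivity) (div_le_self hR'0.le hR)
  have hlog0 : 0 ≤ Real.log (R' / R) := Real.log_nonneg ((one_le_div hR0).2 hRR)
  rw [hval, Finset.sum_mul]
  have h1 : ∀ a ∈ S, a ≠ 0 →
      (D a : ℝ) * Real.log (R' / R) ≤ (E a : ℝ) * Real.log (R' * ‖a‖⁻¹) := by
    intro a ha ha0
    rw [hEin a ((hS a ha).trans hRR), ← div_eq_mul_inv]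
    refine mul_le_mul_of_nonneg_left (Real.log_le_log (by positivity) ?_) (hD' a)
    exact div_le_div_of_nonneg_left hR'0.le (norm_pos_iff.2 ha0) (hS a ha)
  have h2 : ∑ a ∈ S, (D a : ℝ) * Real.log (R' / R) ≤
      ∑ a ∈ S, ((E a : ℝ) * Real.log (R' * ‖a‖⁻¹) +
        if a = 0 then (D 0 : ℝ) * Real.log R' else 0) := by
    refine Finset.sum_le_sum fun a ha => ?_
    rcases eq_or_ne a 0 with rfl | ha0
    · simpa using mul_le_mul_of_nonneg_left hlog (hD' 0)
    · simpa [ha0] using h1 a ha ha0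
  have h3 : ∑ a ∈ S, (if a = 0 then (D 0 : ℝ) * Real.log R' else 0) ≤
      (D 0 : ℝ) * Real.log R' := by
    rw [Finset.sum_ite_eq']
    split_ifs
    · exact le_rfl
    · exact mul_nonneg (hD' 0) (hlog0.trans hlog)
  rw [Finset.sum_add_distrib] at h2
  linarith

/-- The number of zeros and poles in a disc is controlled by the characteristic. -/
theorem zeroPoleCount_mul_log_le {u : ℂ → ℂ} (hu : Meromorphic u) {R R' : ℝ} (hR : 1 ≤ R)
    (hRR : R ≤ R') :
    zeroPoleCount u R * Real.log (R' / R) ≤ 2 * ValueDistribution.characteristic u ⊤ R' +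
      |Real.log ‖meromorphicTrailingCoeffAt u 0‖| := by
  have hR' : 1 ≤ R' := hR.trans hRR
  set D := MeromorphicOn.divisor u Set.univ with hD
  have hS : ∀ a ∈ zeroPoleSet u R, ‖a‖ ≤ R := fun a ha => ((mem_zeroPoleSet hu).1 ha).1
  have h1 := sum_mul_log_le_logCounting (posPart_nonneg D) hR hRR _ hS
  have h2 := sum_mul_log_le_logCounting (negPart_nonneg D) hR hRR _ hS
  have h3 : zeroPoleCount u R =
      (∑ a ∈ zeroPoleSet u R, ((D⁺ a : ℤ) : ℝ)) + ∑ a ∈ zeroPoleSet u R, ((D⁻ a : ℤ) : ℝ) := by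
    rw [← Finset.sum_add_distrib]
    refine Finset.sum_congr rfl fun a _ => ?_
    rw [Function.locallyFinsuppWithin.posPart_apply, Function.locallyFinsuppWithin.negPart_apply,
      ← Int.cast_add, posPart_add_negPart, ← hD, Int.cast_abs]
  rw [h3, add_mul]
  have h4 := ValueDistribution.characteristic_sub_characteristic_inv_of_ne_zero (R := R') hu
    (by linarith)
  have h5 : 0 ≤ ValueDistribution.proximity u ⊤ R' := ValueDistribution.proximity_nonneg R'
  have h6 : 0 ≤ ValueDistribution.proximity u⁻¹ ⊤ R' := ValueDistribution.proximity_nonneg R'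
  have h7 : ∀ f : ℂ → ℂ, ValueDistribution.characteristic f ⊤ R' =
    ValueDistribution.proximity f ⊤ R' + ValueDistribution.logCounting f ⊤ R' := fun f => rfl
  have h8 := neg_abs_le (Real.log ‖meromorphicTrailingCoeffAt u 0‖)
  rw [h7 u, h7 u⁻¹, ValueDistribution.logCounting_inv, ValueDistribution.logCounting_top,
    ValueDistribution.logCounting_zero] at h4
  rw [h7 u, ValueDistribution.logCounting_top]
  linarith

/-- Pointwise bound for `log ‖u‖` away from the zeros and poles of `u`. -/
theorem abs_log_norm_le_of_dist {u : ℂ → ℂ} (hu : Meromorphic u)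
    (htop : ∀ z, meromorphicOrderAt u z ≠ ⊤) {R d : ℝ} (hR : 1 ≤ R) {w : ℂ} (hw : ‖w‖ < R)
    (hua : AnalyticAt ℂ u w) (hu0 : u w ≠ 0) (hd : 0 < d)
    (hdist : ∀ a ∈ zeroPoleSet u R, d ≤ ‖w - a‖) :
    |Real.log ‖u w‖| ≤ zeroPoleCount u R * (1 / d + 2 * R) +
      (R + ‖w‖) / (R - ‖w‖) * (2 * ValueDistribution.characteristic u ⊤ R +
        |Real.log ‖meromorphicTrailingCoeffAt u 0‖| + zeroPoleCount u R * (4 * R)) := by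
  obtain ⟨g, hga, hg0, hgc, hgw⟩ := exists_analytic_factor hu htop R
  have hS : ∀ a ∈ zeroPoleSet u R, ‖a‖ ≤ R := fun a ha => ((mem_zeroPoleSet hu).1 ha).1
  rw [hgw w hw hua hu0]
  refine (abs_add_le _ _).trans (add_le_add ?_ ?_)
  · rw [zeroPoleCount, Finset.sum_mul]
    refine (Finset.abs_sum_le_sum_abs _ _).trans (Finset.sum_le_sum fun a ha => ?_)
    rw [abs_mul]
    refine mul_le_mul_of_nonneg_left ?_ (abs_nonneg _)
    have h1 := hdist a ha
    have hpos : 0 < ‖w - a‖ := hd.trans_le h1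
    have h2 : ‖w - a‖ ≤ 2 * R := (norm_sub_le w a).trans (by linarith [hS a ha])
    have h3 : 1 / ‖w - a‖ ≤ 1 / d := one_div_le_one_div_of_le hd h1
    have h4 := Real.log_le_sub_one_of_pos hpos
    have h5 := Real.log_le_sub_one_of_pos (inv_pos.2 hpos)
    rw [Real.log_inv, ← one_div] at h5
    have h6 : 0 < 1 / d := by positivity
    exact abs_le.2 ⟨by linarith, by linarith⟩
  · have h1 := abs_log_norm_le_mul_circleAverage hga hg0 hw
    have h2 := circleAverage_abs_log_norm_factor_le hu hR _
      (fun a => MeromorphicOn.divisor u Set.univ a) hS hgc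
    have h3 : Real.log (2 * R) ≤ 2 * R := by
      linarith [Real.log_le_sub_one_of_pos (show 0 < 2 * R by linarith)]
    have h4 : 0 ≤ (R + ‖w‖) / (R - ‖w‖) :=
      div_nonneg (by linarith [norm_nonneg w]) (by linarith)
    refine h1.trans (mul_le_mul_of_nonneg_left (h2.trans ?_) h4)
    have h5 : zeroPoleCount u R * (2 * Real.log (2 * R)) ≤ zeroPoleCount u R * (4 * R) :=
      mul_le_mul_of_nonneg_left (by linarith) (zeroPoleCount_nonneg u R)
    exact add_le_add_right h5 _

/-- The first three derivatives of `U * exp l` at a point where `l` vanishes. -/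
theorem iteratedDeriv_of_eq_mul_exp {u l : ℂ → ℂ} {z U : ℂ} (hl : AnalyticAt ℂ l z)
    (hl0 : l z = 0) (h : u =ᶠ[𝓝 z] fun w => U * Complex.exp (l w)) :
    deriv u z = U * iteratedDeriv 1 l z ∧
    iteratedDeriv 2 u z = U * (iteratedDeriv 2 l z + iteratedDeriv 1 l z ^ 2) ∧
    iteratedDeriv 3 u z = U * (iteratedDeriv 3 l z +
      3 * iteratedDeriv 1 l z * iteratedDeriv 2 l z + iteratedDeriv 1 l z ^ 3) := by
  have hA : ∀ᶠ w in 𝓝 z, AnalyticAt ℂ l w := hl.eventually_analyticAt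
  have h1 : deriv u =ᶠ[𝓝 z] fun w => U * Complex.exp (l w) * deriv l w := by
    filter_upwards [h.deriv, hA] with w hw hlw
    rw [hw]
    have := (hlw.differentiableAt.hasDerivAt.cexp.const_mul U).deriv
    rw [this]
    ring
  have h2 : deriv (deriv u) =ᶠ[𝓝 z]
      fun w => U * Complex.exp (l w) * (deriv (deriv l) w + deriv l w ^ 2) := by
    filter_upwards [h1.deriv, hA] with w hw hlw
    rw [hw]
    have := ((hlw.differentiableAt.hasDerivAt.cexp.const_mul U).mul
      hlw.deriv.differentiableAt.hasDerivAt).deriv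
    refine Eq.trans this ?_
    ring
  have h3 : deriv (deriv (deriv u)) =ᶠ[𝓝 z] fun w => U * Complex.exp (l w) *
      (deriv (deriv (deriv l)) w + 3 * deriv l w * deriv (deriv l) w + deriv l w ^ 3) := by
    filter_upwards [h2.deriv, hA] with w hw hlw
    rw [hw]
    have := ((hlw.differentiableAt.hasDerivAt.cexp.const_mul U).mul
      (hlw.deriv.deriv.differentiableAt.hasDerivAt.add
        (hlw.deriv.differentiableAt.hasDerivAt.pow 2))).deriv
    refine Eq.trans this ?_
    simp only [Nat.cast_ofNat, Pi.add_apply, Pi.pow_apply]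
    ring
  simp only [iteratedDeriv_succ, iteratedDeriv_zero]
  rw [h1.eq_of_nhds, h2.eq_of_nhds, h3.eq_of_nhds, hl0, Complex.exp_zero, mul_one]
  exact ⟨rfl, rfl, rfl⟩

/-- A solution of (E) is polynomially bounded by its logarithmic derivatives. -/
theorem exists_norm_le_of_satisfiesE (b c K s₁ s₂ s₃ : ℂ) (hc : c ≠ 0) :
    ∃ C : ℝ, 1 ≤ C ∧ ∀ (u l : ℂ → ℂ) (z : ℂ) (A : ℝ), SatisfiesE b c K s₁ s₂ s₃ u z →
      AnalyticAt ℂ l z → l z = 0 → (u =ᶠ[𝓝 z] fun w => u z * Complex.exp (l w)) →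
      1 ≤ ‖u z‖ → 1 ≤ A → ‖iteratedDeriv 1 l z‖ ≤ A → ‖iteratedDeriv 2 l z‖ ≤ A →
      ‖iteratedDeriv 3 l z‖ ≤ A → ‖u z‖ ≤ C * A ^ 4 := by
  set c₄ : ℂ := 3*s₁^4 - 6*s₁^2*s₂ + 4*s₁*s₃ with hc₄
  set C : ℝ := ‖c^2 / 30‖ * (7 + 30 * ‖b‖ + ‖K‖) +
    (4 * ‖s₁‖ + 6 * ‖s₂‖ + 4 * ‖s₃‖ + ‖c₄‖) + 1 with hC
  refine ⟨C, by rw [hC]; linarith [show 0 ≤ ‖c^2 / 30‖ * (7 + 30 * ‖b‖ + ‖K‖) by positivity,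
    show 0 ≤ 4 * ‖s₁‖ + 6 * ‖s₂‖ + 4 * ‖s₃‖ + ‖c₄‖ by positivity], ?_⟩
  intro u l z A hE hl hl0 h hu1 hA h1 h2 h3
  obtain ⟨e1, e2, e3⟩ := iteratedDeriv_of_eq_mul_exp hl hl0 h
  unfold SatisfiesE at hE
  rw [e1, e2, e3] at hE
  set U := u z
  set p := iteratedDeriv 1 l z
  set q := iteratedDeriv 2 l z
  set t := iteratedDeriv 3 l z
  set L : ℂ := p * (t + 3 * p * q + p ^ 3) - (1/2) * (q + p ^ 2) ^ 2 + 30 * b * p ^ 2 with hL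
  have key : U ^ 4 = c^2 / 30 * (U ^ 2 * L - K) +
      (4 * s₁ * U ^ 3 - 6 * s₂ * U ^ 2 + 4 * s₃ * U - c₄) := by
    have hc2 : c ^ 2 ≠ 0 := pow_ne_zero _ hc
    rw [← hE, hL, hc₄]
    field_simp
    ring
  set N := ‖U‖
  have hA1 : ∀ k : ℕ, k ≤ 4 → A ^ k ≤ A ^ 4 := fun k hk => pow_le_pow_right₀ hA hk
  have hA0 : 0 ≤ A := by linarith
  have a2 := hA1 2 (by norm_num)
  have a3 := hA1 3 (by norm_num)
  have a4 : 1 ≤ A ^ 4 := by simpa using hA1 0 (by norm_num)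
  have hLb : ‖L‖ ≤ (7 + 30 * ‖b‖) * A ^ 4 := by
    have b1 : ‖p * (t + 3 * p * q + p ^ 3)‖ ≤ A * (A + 3 * A * A + A ^ 3) := by
      rw [norm_mul]
      refine mul_le_mul h1 ((norm_add₃_le).trans ?_) (norm_nonneg _) hA0
      rw [norm_mul, norm_mul, norm_pow, Complex.norm_ofNat]
      gcongr
    have b2 : ‖(1/2) * (q + p ^ 2) ^ 2‖ ≤ 1 / 2 * (A + A ^ 2) ^ 2 := by
      rw [norm_mul, norm_pow]
      have : ‖q + p ^ 2‖ ≤ A + A ^ 2 := by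
        refine (norm_add_le _ _).trans ?_
        rw [norm_pow]
        gcongr
      have h' : ‖(1/2 : ℂ)‖ = 1 / 2 := by simp
      rw [h']
      gcongr
    have b3 : ‖30 * b * p ^ 2‖ ≤ 30 * ‖b‖ * A ^ 2 := by
      rw [norm_mul, norm_mul, norm_pow, Complex.norm_ofNat]
      gcongr
    have b4 : ‖L‖ ≤ ‖p * (t + 3 * p * q + p ^ 3)‖ + ‖(1/2) * (q + p ^ 2) ^ 2‖ +
        ‖30 * b * p ^ 2‖ :=
      (norm_add_le _ _).trans (add_le_add_left (norm_sub_le _ _) _)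
    have b5 : 30 * ‖b‖ * A ^ 2 ≤ 30 * ‖b‖ * A ^ 4 := by gcongr
    nlinarith
  have hN3 : ∀ k : ℕ, k ≤ 3 → N ^ k ≤ N ^ 3 := fun k hk => pow_le_pow_right₀ hu1 hk
  have n2 := hN3 2 (by norm_num)
  have n1 : N ≤ N ^ 3 := by simpa using hN3 1 (by norm_num)
  have n0 : 1 ≤ N ^ 3 := by simpa using hN3 0 (by norm_num)
  have k1 : ‖c^2 / 30 * (U ^ 2 * L - K)‖ ≤
      ‖c^2 / 30‖ * (N ^ 3 * ((7 + 30 * ‖b‖) * A ^ 4) + N ^ 3 * (‖K‖ * A ^ 4)) := by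
    rw [norm_mul]
    refine mul_le_mul_of_nonneg_left ((norm_sub_le _ _).trans (add_le_add ?_ ?_)) (norm_nonneg _)
    · rw [norm_mul, norm_pow]
      gcongr
    · calc ‖K‖ = 1 * (‖K‖ * 1) := by ring
        _ ≤ _ := by gcongr
  have k2 : ‖4 * s₁ * U ^ 3 - 6 * s₂ * U ^ 2 + 4 * s₃ * U - c₄‖ ≤
      N ^ 3 * (4 * ‖s₁‖ + 6 * ‖s₂‖ + 4 * ‖s₃‖ + ‖c₄‖) := by
    have j1 : ‖4 * s₁ * U ^ 3 - 6 * s₂ * U ^ 2 + 4 * s₃ * U - c₄‖ ≤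
        ‖4 * s₁ * U ^ 3‖ + ‖6 * s₂ * U ^ 2‖ + ‖4 * s₃ * U‖ + ‖c₄‖ :=
      (norm_sub_le _ _).trans (add_le_add_left ((norm_add_le _ _).trans
        (add_le_add_left (norm_sub_le _ _) _)) _)
    simp only [norm_mul, norm_pow, Complex.norm_ofNat] at j1
    have j2 : ‖s₂‖ * N ^ 2 ≤ ‖s₂‖ * N ^ 3 := by gcongr
    have j3 : ‖s₃‖ * N ≤ ‖s₃‖ * N ^ 3 := by gcongr
    have j4 : ‖c₄‖ * 1 ≤ ‖c₄‖ * N ^ 3 := by gcongr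
    nlinarith
  have k3 : N ^ 3 * (4 * ‖s₁‖ + 6 * ‖s₂‖ + 4 * ‖s₃‖ + ‖c₄‖) ≤
      N ^ 3 * ((4 * ‖s₁‖ + 6 * ‖s₂‖ + 4 * ‖s₃‖ + ‖c₄‖) * A ^ 4) := by
    gcongr
    exact le_mul_of_one_le_right (by positivity) a4
  have k4 : N ^ 4 ≤ N ^ 3 * (C * A ^ 4) := by
    have : N ^ 4 ≤ ‖c^2 / 30 * (U ^ 2 * L - K)‖ +
        ‖4 * s₁ * U ^ 3 - 6 * s₂ * U ^ 2 + 4 * s₃ * U - c₄‖ := by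
      rw [← norm_pow, key]
      exact norm_add_le _ _
    have h5 : N ^ 3 * (C * A ^ 4) = ‖c^2 / 30‖ * (N ^ 3 * ((7 + 30 * ‖b‖) * A ^ 4) +
        N ^ 3 * (‖K‖ * A ^ 4)) + N ^ 3 * ((4 * ‖s₁‖ + 6 * ‖s₂‖ + 4 * ‖s₃‖ + ‖c₄‖) * A ^ 4) +
        N ^ 3 * A ^ 4 := by rw [hC]; ring
    have h6 : 0 ≤ N ^ 3 * A ^ 4 := by positivity
    linarith
  have hN0 : 0 < N ^ 3 := by linarith
  refine le_of_mul_le_mul_left ?_ hN0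
  calc N ^ 3 * N = N ^ 4 := by ring
    _ ≤ _ := k4

theorem AnalyticAt.not_isPoleAt {u : ℂ → ℂ} {z : ℂ} (h : AnalyticAt ℂ u z) : ¬ IsPoleAt u z :=
  fun hp => not_tendsto_nhds_of_tendsto_atTop hp _
    (h.continuousAt.norm.tendsto.mono_left nhdsWithin_le_nhds)

theorem MeromorphicOnPlane.countable_poles {u : ℂ → ℂ} (hu : MeromorphicOnPlane u) :
    {z | IsPoleAt u z}.Countable := by
  have hM : ∀ M : ℕ, {z | IsPoleAt u z ∧ ‖u z‖ ≤ M}.Countable := by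
    intro M
    have hnhds : ∀ x, {z | IsPoleAt u z ∧ ‖u z‖ ≤ M → z = x} ∈ 𝓝 x := by
      intro x
      rcases hu x with hx | hx
      · filter_upwards [hx.eventually_analyticAt] with z hz h
        exact absurd h.1 hz.not_isPoleAt
      · have h1 : ∀ᶠ z in 𝓝[≠] x, (M : ℝ) < ‖u z‖ := hx.eventually_gt_atTop _
        rw [eventually_nhdsWithin_iff] at h1
        filter_upwards [h1] with z hz h
        by_contra hne
        exact absurd (hz hne) (not_lt.2 h.2)
    obtain ⟨t, ht, htu⟩ := TopologicalSpace.countable_cover_nhds hnhds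
    refine ht.mono fun z hz => ?_
    have hzu : z ∈ ⋃ x ∈ t, {z | IsPoleAt u z ∧ ‖u z‖ ≤ M → z = x} := htu ▸ Set.mem_univ z
    simp only [Set.mem_iUnion] at hzu
    obtain ⟨x, hxt, hx⟩ := hzu
    rwa [hx hz]
  refine (Set.countable_iUnion hM).mono fun z hz => ?_
  obtain ⟨M, hMz⟩ := exists_nat_ge ‖u z‖
  exact Set.mem_iUnion.2 ⟨M, hz, hMz⟩

open scoped Classical in
theorem MeromorphicOnPlane.meromorphic {u : ℂ → ℂ} (hu : MeromorphicOnPlane u) :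
    Meromorphic u := by
  intro z₀
  rcases hu z₀ with h | hpole
  · exact h.meromorphicAt
  have h1 : ∀ᶠ z in 𝓝[≠] z₀, 1 < ‖u z‖ := hpole.eventually_gt_atTop 1
  rw [eventually_nhdsWithin_iff, Metric.eventually_nhds_iff_ball] at h1
  obtain ⟨ε, hε, hball⟩ := h1
  set v : ℂ → ℂ := fun z => if IsPoleAt u z then 0 else (u z)⁻¹ with hv
  have hva : ∀ z ∈ Metric.ball z₀ ε, ¬ IsPoleAt u z → v z ≠ 0 ∧ DifferentiableAt ℂ v z := by
    intro z hz hzp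
    have hza := (hu z).resolve_right hzp
    have hzne : z ≠ z₀ := fun h => hzp (h ▸ hpole)
    have hz0 : u z ≠ 0 := norm_pos_iff.1 (zero_lt_one.trans (hball z hz hzne))
    refine ⟨by simp [hv, hzp, hz0], ?_⟩
    refine (hza.differentiableAt.inv hz0).congr_of_eventuallyEq ?_
    filter_upwards [hza.eventually_analyticAt] with w hw
    simp [hv, hw.not_isPoleAt]
  have hvp : ∀ z, IsPoleAt u z → ContinuousAt v z := by
    intro z hz
    have hvz : v z = 0 := by simp [hv, hz]
    rw [← continuousWithinAt_compl_self, ContinuousWithinAt, hvz]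
    refine squeeze_zero_norm (a := fun w => ‖u w‖⁻¹) (fun w => ?_)
      (tendsto_inv_atTop_zero.comp hz)
    by_cases hw : IsPoleAt u w
    · simp [hv, hw]
    · simp [hv, hw]
  have hcont : ∀ z ∈ Metric.ball z₀ ε, ContinuousAt v z := by
    intro z hz
    by_cases hzp : IsPoleAt u z
    · exact hvp z hzp
    · exact (hva z hz hzp).2.continuousAt
  have hsub : Metric.closedBall z₀ (ε / 2) ⊆ Metric.ball z₀ ε :=
    Metric.closedBall_subset_ball (by linarith)
  have han : AnalyticAt ℂ v z₀ := by
    have := Complex.hasFPowerSeriesOnBall_of_differentiable_off_countable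
      (R := ⟨ε / 2, by positivity⟩) (c := z₀) (f := v) hu.countable_poles
      (fun z hz => (hcont z (hsub hz)).continuousWithinAt)
      (fun z hz => (hva z (hsub (Metric.ball_subset_closedBall hz.1)) hz.2).2)
      (by exact_mod_cast half_pos hε)
    exact this.analyticAt
  rcases han.eventually_eq_zero_or_eventually_ne_zero with h0 | h0
  · exfalso
    rw [Metric.eventually_nhds_iff_ball] at h0
    obtain ⟨δ, hδ, h0⟩ := h0
    have hmin : 0 < min δ ε := lt_min hδ hε
    have hsubset : Metric.ball z₀ (min δ ε) ⊆ {z | IsPoleAt u z} := by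
      intro z hz
      by_contra hzp
      exact (hva z (Metric.ball_subset_ball (min_le_right _ _) hz) hzp).1
        (h0 z (Metric.ball_subset_ball (min_le_left _ _) hz))
    have hcard := (hu.countable_poles.mono hsubset).dense_compl ℂ
    obtain ⟨z, hz1, hz2⟩ := hcard.exists_mem_open Metric.isOpen_ball
      ⟨z₀, Metric.mem_ball_self hmin⟩
    exact hz1 hz2
  · refine han.meromorphicAt.inv.congr ?_
    filter_upwards [h0] with z hz
    have hzp : ¬ IsPoleAt u z := fun h => hz (by simp [hv, h])
    simp [hv, hzp]

theorem isPoleAt_iff_meromorphicOrderAt_neg {u : ℂ → ℂ} {z : ℂ} (hu : MeromorphicAt u z) :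
    IsPoleAt u z ↔ meromorphicOrderAt u z < 0 := by
  rw [← tendsto_cobounded_iff_meromorphicOrderAt_neg hu, ← tendsto_norm_atTop_iff_cobounded]
  rfl

theorem MeromorphicOnPlane.analyticAt_of_nonneg {u : ℂ → ℂ} (hu : MeromorphicOnPlane u) {z : ℂ}
    (h : 0 ≤ meromorphicOrderAt u z) : AnalyticAt ℂ u z :=
  (hu z).resolve_right fun hp =>
    absurd ((isPoleAt_iff_meromorphicOrderAt_neg (hu.meromorphic z)).1 hp) (not_lt.2 h)

theorem meromorphicOrderAt_ne_top_of_not_isRational {u : ℂ → ℂ} (hu : MeromorphicOnPlane u)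
    (htrans : ¬ IsRationalFunction u) (z : ℂ) : meromorphicOrderAt u z ≠ ⊤ := by
  by_contra hz
  apply htrans
  have hall : ∀ w, meromorphicOrderAt u w = ⊤ := by
    by_contra! h
    exact hu.meromorphic.exists_meromorphicOrderAt_ne_top_iff_forall.1 h z hz
  refine ⟨0, 1, one_ne_zero, fun w hw _ => ?_⟩
  have h1 : ∀ᶠ x in 𝓝[≠] w, u x = 0 := meromorphicOrderAt_eq_top_iff.1 (hall w)
  have h2 := (hw.continuousAt.eventuallyEq_nhds_iff_eventuallyEq_nhdsNE
    (continuousAt_const (y := (0 : ℂ)))).1 h1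
  simpa using h2.eq_of_nhds

/-- A meromorphic function on the plane is analytic and nonzero outside the support of its
divisor. -/
theorem MeromorphicOnPlane.analyticAt_and_ne_zero {u : ℂ → ℂ} (hu : MeromorphicOnPlane u)
    (htop : ∀ z, meromorphicOrderAt u z ≠ ⊤) {w : ℂ}
    (hw : MeromorphicOn.divisor u Set.univ w = 0) : AnalyticAt ℂ u w ∧ u w ≠ 0 := by
  rw [MeromorphicOn.divisor_apply hu.meromorphic.meromorphicOn (Set.mem_univ w),
    WithTop.untop₀_eq_zero] at hw
  have h0 : meromorphicOrderAt u w = 0 := hw.resolve_right (htop w)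
  have ha := hu.analyticAt_of_nonneg h0.ge
  refine ⟨ha, ?_⟩
  rw [ha.meromorphicOrderAt_eq] at h0
  refine ha.analyticOrderAt_eq_zero.1 ?_
  cases h : analyticOrderAt u w with
  | top => simp [h] at h0
  | coe n =>
    rw [h] at h0
    simpa using h0

theorem poleOrderAt_eq_negPart {u : ℂ → ℂ} {p : ℂ} (hu : MeromorphicAt u p)
    (htop : meromorphicOrderAt u p ≠ ⊤) :
    (poleOrderAt u p : ℤ) = (meromorphicOrderAt u p).untop₀⁻ := by
  obtain ⟨k, hk⟩ := WithTop.ne_top_iff_exists.1 htop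
  have hset : {n : ℕ | ∃ α : ℂ, Tendsto (fun z => (z - p) ^ n * u z) (𝓝[≠] p) (𝓝 α)} =
      Set.Ici (-k).toNat := by
    ext n
    have hpow : MeromorphicAt (fun z => (z - p) ^ n) p := by fun_prop
    have hord : meromorphicOrderAt (fun z => (z - p) ^ n) p = ((n : ℤ) : WithTop ℤ) := by
      rw [meromorphicOrderAt_eq_int_iff hpow]
      exact ⟨1, analyticAt_const, one_ne_zero, by simp⟩
    have hmul := meromorphicOrderAt_mul hpow hu
    rw [hord, ← hk, ← WithTop.coe_add] at hmul
    have h1 := tendsto_nhds_iff_meromorphicOrderAt_nonneg (hpow.mul hu)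
    rw [hmul] at h1
    rw [Set.mem_ofPred_eq, Set.mem_Ici, Int.toNat_le]
    refine h1.trans ?_
    rw [← WithTop.coe_zero, WithTop.coe_le_coe]
    constructor <;> intro h <;> linarith
  have hinf : poleOrderAt u p = (-k).toNat := by
    rw [poleOrderAt, hset, csInf_Ici]
  rw [hinf, ← hk, WithTop.untop₀_coe, Int.toNat_eq_max, negPart_def]

theorem unintegratedCounting_eq_sum {u : ℂ → ℂ} (hu : Meromorphic u)
    (htop : ∀ z, meromorphicOrderAt u z ≠ ⊤) {t r : ℝ} (htr : t ≤ r) :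
    unintegratedCounting u t = ∑ a ∈ zeroPoleSet u r,
      if ‖a‖ ≤ t then (((MeromorphicOn.divisor u Set.univ)⁻ a : ℤ) : ℝ) else 0 := by
  have hval : ∀ a, (MeromorphicOn.divisor u Set.univ)⁻ a = (meromorphicOrderAt u a).untop₀⁻ := by
    intro a
    rw [Function.locallyFinsuppWithin.negPart_apply,
      MeromorphicOn.divisor_apply hu.meromorphicOn (Set.mem_univ a)]
  rw [unintegratedCounting, tsum_subtype {p : ℂ | IsPoleAt u p ∧ ‖p‖ ≤ t}
    (fun p => (poleOrderAt u p : ℝ)), tsum_eq_sum (s := zeroPoleSet u r)]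
  · refine Finset.sum_congr rfl fun a _ => ?_
    by_cases hat : ‖a‖ ≤ t
    · by_cases hp : IsPoleAt u a
      · rw [Set.indicator_of_mem (show a ∈ {p : ℂ | IsPoleAt u p ∧ ‖p‖ ≤ t} from ⟨hp, hat⟩),
          if_pos hat, hval, ← poleOrderAt_eq_negPart (hu a) (htop a), Int.cast_natCast]
      · rw [Set.indicator_of_notMem (fun h => hp h.1), if_pos hat, hval]
        rw [isPoleAt_iff_meromorphicOrderAt_neg (hu a), not_lt] at hp
        rw [negPart_eq_zero.2 (WithTop.untop₀_nonneg.2 hp), Int.cast_zero]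
    · rw [Set.indicator_of_notMem (fun h => hat h.2), if_neg hat]
  · intro a ha
    refine Set.indicator_of_notMem (fun h => ha ?_) _
    rw [mem_zeroPoleSet hu, MeromorphicOn.divisor_apply hu.meromorphicOn (Set.mem_univ a)]
    refine ⟨h.2.trans htr, fun h0 => ?_⟩
    have h1 := (isPoleAt_iff_meromorphicOrderAt_neg (hu a)).1 h.1
    rcases (WithTop.untop₀_eq_zero).1 h0 with h2 | h2
    · simp [h2] at h1
    · exact htop a h2

theorem integral_ite_le_div {ρ r : ℝ} (hρ : 0 < ρ) (hr : ρ ≤ r) :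
    IntervalIntegrable (fun t => if ρ ≤ t then 1 / t else 0) volume 0 r ∧
      ∫ t in (0 : ℝ)..r, (if ρ ≤ t then 1 / t else 0) = Real.log (r * ρ⁻¹) := by
  have hr0 : 0 ≤ r := hρ.le.trans hr
  have hfun : (fun t : ℝ => if ρ ≤ t then 1 / t else 0) =
      (Set.Ici ρ).indicator (fun t => 1 / t) := by
    ext t
    by_cases h : ρ ≤ t <;> simp [h]
  have hinter : Set.Ici ρ ∩ Set.Ioc 0 r = Set.Icc ρ r := by
    ext t
    simp only [Set.mem_inter_iff, Set.mem_Ici, Set.mem_Ioc, Set.mem_Icc]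
    constructor
    · rintro ⟨h1, _, h2⟩
      exact ⟨h1, h2⟩
    · rintro ⟨h1, h2⟩
      exact ⟨h1, hρ.trans_le h1, h2⟩
  rw [hfun]
  constructor
  · rw [intervalIntegrable_iff_integrableOn_Ioc_of_le hr0]
    have h1 : IntegrableOn (fun t : ℝ => 1 / t) (Set.Icc ρ r) :=
      ContinuousOn.integrableOn_Icc (continuousOn_const.div continuousOn_id
        fun t ht => (hρ.trans_le ht.1).ne')
    rw [IntegrableOn, integrable_indicator_iff measurableSet_Ici, IntegrableOn,
      Measure.restrict_restrict measurableSet_Ici, hinter]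
    exact h1
  · rw [intervalIntegral.integral_of_le hr0, setIntegral_indicator measurableSet_Ici,
      Set.inter_comm, hinter, integral_Icc_eq_integral_Ioc, ← intervalIntegral.integral_of_le hr,
      integral_one_div_of_pos hρ (hρ.trans_le hr), div_eq_mul_inv]

theorem integratedCounting_eq_logCounting {u : ℂ → ℂ} (hu : Meromorphic u)
    (htop : ∀ z, meromorphicOrderAt u z ≠ ⊤) {r : ℝ} (hr : 1 ≤ r) :
    integratedCounting u r = ValueDistribution.logCounting u ⊤ r := by
  have hr0 : 0 < r := by linarith
  set P : ℂ → ℝ := fun a => (((MeromorphicOn.divisor u Set.univ)⁻ a : ℤ) : ℝ) with hP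
  set S := zeroPoleSet u r with hS
  have hPS : ∀ a, ‖a‖ ≤ r → a ∉ S → P a = 0 := by
    intro a ha haS
    have h0 : MeromorphicOn.divisor u Set.univ a = 0 := by
      by_contra h
      exact haS ((mem_zeroPoleSet hu).2 ⟨ha, h⟩)
    simp [hP, Function.locallyFinsuppWithin.negPart_apply, h0]
  have hn0 : unintegratedCounting u 0 = P 0 := by
    rw [unintegratedCounting_eq_sum hu htop hr0.le]
    simp only [norm_le_zero_iff]
    rw [Finset.sum_ite_eq']
    split_ifs with h
    · rfl
    · exact (hPS 0 (by simpa using hr0.le) h).symm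
  have hint : ∀ t ∈ Set.Icc 0 r, (unintegratedCounting u t - unintegratedCounting u 0) / t =
      ∑ a ∈ S.erase 0, P a * (if ‖a‖ ≤ t then 1 / t else 0) := by
    intro t ht
    rw [unintegratedCounting_eq_sum hu htop ht.2, unintegratedCounting_eq_sum hu htop hr0.le,
      ← Finset.sum_sub_distrib, Finset.sum_div]
    rw [← Finset.sum_subset (Finset.erase_subset 0 S)]
    · refine Finset.sum_congr rfl fun a ha => ?_
      have ha0 : ¬ ‖a‖ ≤ 0 := by simpa using (Finset.mem_erase.1 ha).1
      rw [if_neg ha0]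
      split_ifs <;> simp [hP, div_eq_mul_inv]
    · intro a haS ha
      have ha0 : a = 0 := by
        by_contra h
        exact ha (Finset.mem_erase.2 ⟨h, haS⟩)
      simp [ha0, ht.1]
  have hI : ∀ a ∈ S.erase 0, 0 < ‖a‖ ∧ ‖a‖ ≤ r := fun a ha =>
    ⟨norm_pos_iff.2 (Finset.mem_erase.1 ha).1,
      ((mem_zeroPoleSet hu).1 (Finset.mem_erase.1 ha).2).1⟩
  have h1 : ∫ t in (0 : ℝ)..r, (unintegratedCounting u t - unintegratedCounting u 0) / t =
      ∑ a ∈ S.erase 0, P a * Real.log (r * ‖a‖⁻¹) := by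
    rw [intervalIntegral.integral_congr (g := fun t => ∑ a ∈ S.erase 0,
      P a * (if ‖a‖ ≤ t then 1 / t else 0)) (by rw [Set.uIcc_of_le hr0.le]; exact hint),
      intervalIntegral.integral_finsetSum fun a ha =>
        (integral_ite_le_div (hI a ha).1 (hI a ha).2).1.const_mul _]
    refine Finset.sum_congr rfl fun a ha => ?_
    rw [intervalIntegral.integral_const_mul, (integral_ite_le_div (hI a ha).1 (hI a ha).2).2]
  rw [integratedCounting, h1, hn0, ValueDistribution.logCounting_top]
  set D := (MeromorphicOn.divisor u Set.univ)⁻ with hD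
  set E := Function.locallyFinsuppWithin.toClosedBall r D with hE
  have hval : Function.locallyFinsuppWithin.logCounting D r =
      (∑ᶠ z, (E z : ℝ) * Real.log (r * ‖z‖⁻¹)) + (D 0 : ℝ) * Real.log r := rfl
  have hEin : ∀ z, ‖z‖ ≤ r → E z = D z := fun z hz =>
    Function.locallyFinsuppWithin.toClosedBall_eval_within D
      (by simpa [abs_of_pos hr0] using hz)
  have hEout : ∀ z, ¬ ‖z‖ ≤ r → E z = 0 := fun z hz =>
    Function.locallyFinsuppWithin.apply_eq_zero_of_notMem _
      (by simpa [abs_of_pos hr0] using hz)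
  rw [hval, add_comm]
  congr 1
  rw [finsum_eq_sum_of_support_subset (s := S.erase 0)]
  · exact Finset.sum_congr rfl fun a ha => by rw [hEin a (hI a ha).2]
  · intro z hz
    rw [Function.mem_support] at hz
    rw [Finset.mem_coe, Finset.mem_erase]
    constructor
    · rintro rfl
      simp at hz
    · by_contra hzS
      apply hz
      by_cases hzr : ‖z‖ ≤ r
      · rw [hEin z hzr]
        have := hPS z hzr hzS
        simp only [hP] at this
        rw [this, zero_mul]
      · simp [hEout z hzr]

theorem proximityFn_eq_proximity (u : ℂ → ℂ) (r : ℝ) :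
    proximityFn u r = ValueDistribution.proximity u ⊤ r := by
  rw [ValueDistribution.proximity_top, Real.circleAverage, proximityFn, smul_eq_mul, one_div]
  simp [Real.posLog, circleMap]

theorem characteristicFn_eq_characteristic {u : ℂ → ℂ} (hu : Meromorphic u)
    (htop : ∀ z, meromorphicOrderAt u z ≠ ⊤) {r : ℝ} (hr : 1 ≤ r) :
    characteristicFn u r = ValueDistribution.characteristic u ⊤ r := by
  rw [characteristicFn, proximityFn_eq_proximity, integratedCounting_eq_logCounting hu htop hr]
  rfl

theorem card_zeroPoleSet_le_zeroPoleCount {u : ℂ → ℂ} (hu : Meromorphic u) (R : ℝ) :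
    ((zeroPoleSet u R).card : ℝ) ≤ zeroPoleCount u R := by
  rw [zeroPoleCount, ← nsmul_one]
  refine Finset.card_nsmul_le_sum _ _ _ fun a ha => ?_
  exact_mod_cast Int.one_le_abs ((mem_zeroPoleSet hu).1 ha).2

/-- If the characteristic grows at most logarithmically along an unbounded set of radii, then
there are only finitely many zeros and poles. -/
theorem finite_support_divisor_of_frequently {u : ℂ → ℂ} (hu : Meromorphic u) {C : ℝ}
    (hC : ∃ᶠ r in atTop, ValueDistribution.characteristic u ⊤ r ≤ C * Real.log r) :
    (MeromorphicOn.divisor u Set.univ).support.Finite := by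
  set c₀ := |Real.log ‖meromorphicTrailingCoeffAt u 0‖| with hc₀
  have hc₀0 : 0 ≤ c₀ := abs_nonneg _
  have hbound : ∀ R : ℝ, 1 ≤ R → zeroPoleCount u R ≤ 4 * C + 2 * c₀ := by
    intro R hR
    obtain ⟨r, hrT, hr⟩ := (hC.and_eventually
      (eventually_ge_atTop (max (R ^ 2) (Real.exp 1)))).exists
    have hr2 : R ^ 2 ≤ r := (le_max_left _ _).trans hr
    have hre : Real.exp 1 ≤ r := (le_max_right _ _).trans hr
    have hr0 : 0 < r := (Real.exp_pos 1).trans_le hre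
    have hR0 : 0 < R := by linarith
    have hlog1 : 1 ≤ Real.log r := (Real.le_log_iff_exp_le hr0).2 hre
    have hRr : R ≤ r := by nlinarith
    have h1 := zeroPoleCount_mul_log_le hu hR hRr
    have h2 : 2 * Real.log R ≤ Real.log r := by
      have := Real.log_le_log (by positivity) hr2
      rwa [Real.log_pow, Nat.cast_ofNat] at this
    rw [Real.log_div hr0.ne' hR0.ne'] at h1
    have h3 : zeroPoleCount u R * (Real.log r / 2) ≤
        zeroPoleCount u R * (Real.log r - Real.log R) :=
      mul_le_mul_of_nonneg_left (by linarith) (zeroPoleCount_nonneg u R)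
    have h4 : c₀ ≤ c₀ * Real.log r := le_mul_of_one_le_right hc₀0 hlog1
    have h5 : zeroPoleCount u R * Real.log r ≤ (4 * C + 2 * c₀) * Real.log r := by
      linarith
    exact le_of_mul_le_mul_right h5 (by linarith)
  by_contra hinf
  obtain ⟨N, hN⟩ := exists_nat_gt (4 * C + 2 * c₀)
  obtain ⟨t, ht, htN⟩ := Set.Infinite.exists_subset_card_eq hinf N
  obtain ⟨R, hR⟩ := (t.finite_toSet.isBounded).exists_norm_le
  have hsub : t ⊆ zeroPoleSet u (max R 1) := fun a ha =>
    (mem_zeroPoleSet hu).2 ⟨(hR a ha).trans (le_max_left _ _), ht ha⟩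
  have h1 : (N : ℝ) ≤ (zeroPoleSet u (max R 1)).card := by
    rw [← htN]
    exact_mod_cast Finset.card_le_card hsub
  linarith [card_zeroPoleSet_le_zeroPoleCount hu (max R 1), hbound (max R 1) (le_max_right _ _)]

/-- A zero-free entire function whose logarithmic modulus has logarithmic mean growth along an
unbounded set of radii is constant. -/
theorem deriv_eq_zero_of_frequently_circleAverage_le {g : ℂ → ℂ} (hg : Differentiable ℂ g)
    (hne : ∀ z, g z ≠ 0) {C : ℝ} (hC : 0 < C)
    (h : ∃ᶠ r in atTop, Real.circleAverage (fun z => |Real.log ‖g z‖|) 0 r ≤ C * Real.log r)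
    (z : ℂ) : deriv g z = 0 := by
  have hlim : Tendsto (fun r : ℝ => ‖g z‖ * (96 * C * (Real.log r / r))) atTop (𝓝 0) := by
    have := (Real.isLittleO_log_id_atTop.tendsto_div_nhds_zero.const_mul (96 * C)).const_mul ‖g z‖
    simpa using this
  have hle : ∃ᶠ r in atTop, ‖deriv g z‖ ≤ ‖g z‖ * (96 * C * (Real.log r / r)) := by
    refine (h.and_eventually (eventually_ge_atTop (max 2 (4 * ‖z‖)))).mono ?_
    rintro r ⟨hr, hr1⟩
    have hr2 : 2 ≤ r := (le_max_left _ _).trans hr1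
    have hrz : 4 * ‖z‖ ≤ r := (le_max_right _ _).trans hr1
    have hlog : 0 < Real.log r := Real.log_pos (by linarith)
    have hB : 0 < 3 * (C * Real.log r) := by positivity
    have hη : 0 < r / 4 := by linarith
    obtain ⟨l, hl, hl0, hexp, hder⟩ := exists_local_log (f := g) (z := z) hη
      hg.differentiableOn (fun w _ => hne w) hB (by
        intro w hw
        have hw' : ‖w‖ ≤ r / 2 := by
          have h1 : ‖w - z‖ < r / 4 := by simpa [dist_eq_norm] using hw
          linarith [norm_le_norm_add_norm_sub' w z]
        refine (abs_log_norm_le_mul_circleAverage (R := r) (fun x _ => hg.analyticAt x)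
          (fun x _ => hne x) (by linarith)).trans ?_
        refine mul_le_mul ?_ hr ?_ (by norm_num)
        · rw [div_le_iff₀ (by linarith)]
          linarith
        · exact Real.circleAverage_nonneg_of_nonneg fun x _ => abs_nonneg _)
    have hla : DifferentiableAt ℂ l z := hl.differentiableAt (Metric.ball_mem_nhds z hη)
    have hg' : deriv g z = g z * deriv l z := by
      have heq : g =ᶠ[𝓝 z] fun w => g z * Complex.exp (l w) := by
        filter_upwards [Metric.ball_mem_nhds z hη] with w hw using hexp w hw
      rw [heq.deriv_eq, (hla.hasDerivAt.cexp.const_mul (g z)).deriv, hl0]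
      simp
    have h1 := hder 1
    rw [iteratedDeriv_one] at h1
    rw [hg', norm_mul]
    refine mul_le_mul_of_nonneg_left (h1.trans_eq ?_) (norm_nonneg _)
    have : r ≠ 0 := by linarith
    simp only [Nat.factorial_one, Nat.cast_one, pow_one]
    field_simp
    norm_num
  have h0 : ‖deriv g z‖ ≤ 0 := ge_of_tendsto_of_frequently hlim hle
  simpa using h0

/-- A product of integer powers of linear factors is a quotient of polynomials. -/
theorem exists_polynomial_eq_prod_zpow (S : Finset ℂ) (D : ℂ → ℤ) (γ : ℂ) :
    ∃ p q : Polynomial ℂ, q ≠ 0 ∧ ∀ z : ℂ, (∏ a ∈ S, (z - a) ^ D a) * γ =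
      Polynomial.eval z p / Polynomial.eval z q := by
  refine ⟨Polynomial.C γ * ∏ a ∈ S, (Polynomial.X - Polynomial.C a) ^ (D a).toNat,
    ∏ a ∈ S, (Polynomial.X - Polynomial.C a) ^ (-D a).toNat,
    Finset.prod_ne_zero_iff.2 fun a _ => pow_ne_zero _ (Polynomial.X_sub_C_ne_zero a),
    fun z => ?_⟩
  simp only [Polynomial.eval_mul, Polynomial.eval_C, Polynomial.eval_prod, Polynomial.eval_pow,
    Polynomial.eval_sub, Polynomial.eval_X]
  rw [mul_div_assoc, ← Finset.prod_div_distrib, mul_comm]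
  congr 1
  refine Finset.prod_congr rfl fun a _ => ?_
  rcases le_total 0 (D a) with h | h
  · rw [Int.toNat_of_nonpos (show -D a ≤ 0 by linarith), pow_zero, div_one]
    conv_lhs => rw [← Int.toNat_of_nonneg h]
    rw [zpow_natCast]
  · rw [Int.toNat_of_nonpos h, pow_zero, one_div, ← zpow_natCast,
      Int.toNat_of_nonneg (show 0 ≤ -D a by linarith), zpow_neg, inv_inv]

/-- A meromorphic function whose characteristic grows at most logarithmically along an unbounded
set of radii is rational. -/
theorem isRationalFunction_of_frequently {u : ℂ → ℂ} (hu : Meromorphic u)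
    (htop : ∀ z, meromorphicOrderAt u z ≠ ⊤) {C : ℝ} (hC0 : 0 < C)
    (hC : ∃ᶠ r in atTop, ValueDistribution.characteristic u ⊤ r ≤ C * Real.log r) :
    IsRationalFunction u := by
  set D := MeromorphicOn.divisor u Set.univ with hD
  have hfin : D.support.Finite := finite_support_divisor_of_frequently hu hC
  obtain ⟨g, hga, hg0, hg⟩ := MeromorphicOn.extract_zeros_poles (U := Set.univ) hu.meromorphicOn
    (fun z => htop z) hfin
  have hgd : Differentiable ℂ g := fun z => (hga z (Set.mem_univ z)).differentiableAt
  have hne : ∀ z, g z ≠ 0 := fun z => hg0 ⟨z, Set.mem_univ z⟩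
  set S : Finset ℂ := hfin.toFinset with hS
  have hlog : (fun z => Real.log ‖u z‖) =ᶠ[codiscreteWithin Set.univ]
      fun z => (∑ a ∈ S, (D a : ℝ) * Real.log ‖z - a‖) + Real.log ‖g z‖ := by
    have hlog := MeromorphicOn.extract_zeros_poles_log hg0 hg
    have hsum : (∑ᶠ a, fun z : ℂ => (D a : ℝ) * Real.log ‖z - a‖) =
        fun z => ∑ a ∈ S, (D a : ℝ) * Real.log ‖z - a‖ := by
      rw [finsum_eq_sum_of_support_subset (s := S)]
      · ext z
        rw [Finset.sum_apply]
      · intro a ha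
        simp only [hS, Set.Finite.coe_toFinset, Function.mem_support]
        intro h0
        apply ha
        ext z
        simp [h0]
    rw [hsum] at hlog
    exact hlog
  set c₀ := |Real.log ‖meromorphicTrailingCoeffAt u 0‖| with hc₀
  set s : ℝ := ∑ a ∈ S, |(D a : ℝ)| with hs
  have hs0 : 0 ≤ s := Finset.sum_nonneg fun _ _ => abs_nonneg _
  have hc₀0 : 0 ≤ c₀ := abs_nonneg _
  obtain ⟨ρ, hρ⟩ := (S.finite_toSet.isBounded).exists_norm_le
  have hfreq : ∃ᶠ r in atTop, Real.circleAverage (fun z => |Real.log ‖g z‖|) 0 r ≤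
      (2 * C + c₀ + 4 * s) * Real.log r := by
    refine (hC.and_eventually (eventually_ge_atTop (max ρ (Real.exp 1)))).mono ?_
    rintro r ⟨hrT, hr⟩
    have hrρ : ρ ≤ r := (le_max_left _ _).trans hr
    have hre : Real.exp 1 ≤ r := (le_max_right _ _).trans hr
    have hr0 : 0 < r := (Real.exp_pos 1).trans_le hre
    have hlog1 : 1 ≤ Real.log r := (Real.le_log_iff_exp_le hr0).2 hre
    have hr2 : 2 ≤ r := by linarith [Real.add_one_le_exp 1]
    have h1 := circleAverage_abs_log_norm_factor_le hu (by linarith) S D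
      (fun a ha => (hρ a ha).trans hrρ)
      (hlog.filter_mono (Filter.codiscreteWithin_mono (Set.subset_univ _)))
    have h2 : Real.log (2 * r) ≤ 2 * Real.log r := by
      rw [Real.log_mul two_ne_zero hr0.ne']
      linarith [Real.log_le_log two_pos hr2]
    have h3 : s * (2 * Real.log (2 * r)) ≤ s * (4 * Real.log r) :=
      mul_le_mul_of_nonneg_left (by linarith) hs0
    have h4 : c₀ ≤ c₀ * Real.log r := le_mul_of_one_le_right hc₀0 hlog1
    linarith
  have hconst : ∀ z, g z = g 0 := fun z => is_const_of_deriv_eq_zero hgd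
    (deriv_eq_zero_of_frequently_circleAverage_le hgd hne (by positivity) hfreq) z 0
  obtain ⟨p, q, hq, hpq⟩ := exists_polynomial_eq_prod_zpow S D (g 0)
  refine ⟨p, q, hq, fun z hz hqz => ?_⟩
  have hprod : (∏ᶠ a, (· - a) ^ D a) • g =
      fun z : ℂ => Polynomial.eval z p / Polynomial.eval z q := by
    rw [finprod_eq_prod_of_mulSupport_subset (s := S)]
    · ext z
      rw [← hpq, Pi.smul_apply', Finset.prod_apply, hconst z, smul_eq_mul]
      rfl
    · intro a ha
      simp only [hS, Set.Finite.coe_toFinset, Function.mem_support]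
      intro h0
      apply ha
      change (fun x : ℂ => x - a) ^ D a = 1
      rw [h0, zpow_zero]
  rw [hprod] at hg
  exact eq_of_eventuallyEq_codiscreteWithin hg Filter.univ_mem hz.continuousAt
    (p.continuous.continuousAt.div q.continuous.continuousAt hqz)

/-- The characteristic of a transcendental function grows faster than the logarithm. -/
theorem isLittleO_log_characteristic {u : ℂ → ℂ} (hu : MeromorphicOnPlane u)
    (htrans : ¬ IsRationalFunction u) :
    Real.log =o[atTop] ValueDistribution.characteristic u ⊤ := by
  rw [isLittleO_iff]
  intro ε hε
  by_contra hnot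
  refine htrans (isRationalFunction_of_frequently hu.meromorphic
    (meromorphicOrderAt_ne_top_of_not_isRational hu htrans) (C := ε⁻¹) (by positivity) ?_)
  rw [not_eventually] at hnot
  refine (hnot.and_eventually (eventually_ge_atTop 1)).mono ?_
  rintro r ⟨hr, hr1⟩
  rw [not_le, Real.norm_of_nonneg (Real.log_nonneg hr1)] at hr
  rw [← div_eq_inv_mul, le_div_iff₀' hε]
  exact (mul_le_mul_of_nonneg_left (Real.le_norm_self _) hε.le).trans hr.le

/-- At a radius where the characteristic does not double, the number of zeros and poles is
polynomially bounded. -/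
theorem zeroPoleCount_le_of_characteristic_le {u : ℂ → ℂ} (hu : Meromorphic u) {r t : ℝ}
    (hr : 1 ≤ r) (ht : 1 ≤ t) (ht₀ : |Real.log ‖meromorphicTrailingCoeffAt u 0‖| ≤ t)
    (hT : ValueDistribution.characteristic u ⊤ (r + 1 / t) ≤ 2 * t) :
    zeroPoleCount u (r + 1 / t / 2) ≤ 20 * (r * t) ^ 2 := by
  have ht0 : 0 < t := by linarith
  have hδ : 0 < 1 / t := by positivity
  have hδ1 : 1 / t ≤ 1 := (div_le_one ht0).2 ht
  have h1 := zeroPoleCount_mul_log_le hu (R := r + 1 / t / 2) (R' := r + 1 / t)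
    (by linarith) (by linarith)
  have h2 : 1 / (4 * (r * t)) ≤ Real.log ((r + 1 / t) / (r + 1 / t / 2)) := by
    have h3 := Real.one_sub_inv_le_log_of_pos
      (show 0 < (r + 1 / t) / (r + 1 / t / 2) by positivity)
    refine le_trans ?_ h3
    rw [inv_div, one_sub_div (by positivity), div_le_div_iff₀ (by positivity) (by positivity)]
    have h4 : 1 / t * t = 1 := by field_simp
    nlinarith
  have h5 := (mul_le_mul_of_nonneg_left h2 (zeroPoleCount_nonneg u _)).trans h1
  rw [mul_one_div, div_le_iff₀ (by positivity)] at h5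
  have h6 : (2 * ValueDistribution.characteristic u ⊤ (r + 1 / t) +
      |Real.log ‖meromorphicTrailingCoeffAt u 0‖|) * (4 * (r * t)) ≤ 5 * t * (4 * (r * t)) :=
    mul_le_mul_of_nonneg_right (by linarith) (by positivity)
  have h7 : 5 * t * (4 * (r * t)) ≤ 20 * (r * t) ^ 2 := by
    have : t * (r * t) ≤ r * t * (r * t) :=
      mul_le_mul_of_nonneg_right (le_mul_of_one_le_left ht0.le hr) (by positivity)
    nlinarith
  linarith

/-- Polynomial bound for `|log ‖u‖|` away from zeros and poles. -/
theorem abs_log_norm_le_of_characteristic_le {u : ℂ → ℂ} (hu : Meromorphic u)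
    (htop : ∀ z, meromorphicOrderAt u z ≠ ⊤) {r t : ℝ}
    (hr : 1 ≤ r) (ht : 1 ≤ t) (ht₀ : |Real.log ‖meromorphicTrailingCoeffAt u 0‖| ≤ t)
    (hT : ValueDistribution.characteristic u ⊤ (r + 1 / t) ≤ 2 * t) {w : ℂ}
    (hw : ‖w‖ ≤ r + 1 / t / 4) (hua : AnalyticAt ℂ u w) (hu0 : u w ≠ 0)
    (hdist : ∀ a ∈ zeroPoleSet u (r + 1 / t / 2), 1 / (800 * (r * t) ^ 4) ≤ ‖w - a‖) :
    |Real.log ‖u w‖| ≤ 20000 * (r * t) ^ 6 := by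
  have ht0 : 0 < t := by linarith
  have hδ : 0 < 1 / t := by positivity
  have hδ1 : 1 / t ≤ 1 := (div_le_one ht0).2 ht
  have hn := zeroPoleCount_le_of_characteristic_le hu hr ht ht₀ hT
  have hn0 := zeroPoleCount_nonneg u (r + 1 / t / 2)
  have h1 := abs_log_norm_le_of_dist hu htop (R := r + 1 / t / 2) (by linarith)
    (by linarith) hua hu0 (by positivity) hdist
  have hmono : ValueDistribution.characteristic u ⊤ (r + 1 / t / 2) ≤ 2 * t :=
    (ValueDistribution.characteristic_monotoneOn hu
      (show 0 < r + 1 / t / 2 by positivity) (show 0 < r + 1 / t by positivity)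
      (by linarith)).trans hT
  have hratio : (r + 1 / t / 2 + ‖w‖) / (r + 1 / t / 2 - ‖w‖) ≤ 12 * (r * t) := by
    rw [div_le_iff₀ (by linarith)]
    have h2 : 12 * (r * t) * (1 / t / 4) ≤ 12 * (r * t) * (r + 1 / t / 2 - ‖w‖) :=
      mul_le_mul_of_nonneg_left (by linarith) (by positivity)
    have h3 : 12 * (r * t) * (1 / t / 4) = 3 * r := by field_simp; norm_num
    linarith
  set X := r * t with hX
  have hXt : t ≤ X := le_mul_of_one_le_left ht0.le hr
  have hXr : r ≤ X := le_mul_of_one_le_right (by linarith) ht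
  have hX1 : 1 ≤ X := ht.trans hXt
  have hX0 : 0 ≤ X := by linarith
  have hR : r + 1 / t / 2 ≤ 2 * X := by linarith
  have hA : zeroPoleCount u (r + 1 / t / 2) *
      (1 / (1 / (800 * X ^ 4)) + 2 * (r + 1 / t / 2)) ≤
      20 * X ^ 2 * (800 * X ^ 4 + 4 * X) := by
    rw [one_div_one_div]
    refine mul_le_mul hn (by linarith) ?_ (by positivity)
    positivity
  have hB : 2 * ValueDistribution.characteristic u ⊤ (r + 1 / t / 2) +
      |Real.log ‖meromorphicTrailingCoeffAt u 0‖| +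
      zeroPoleCount u (r + 1 / t / 2) * (4 * (r + 1 / t / 2)) ≤
      5 * X + 20 * X ^ 2 * (8 * X) := by
    have : zeroPoleCount u (r + 1 / t / 2) * (4 * (r + 1 / t / 2)) ≤ 20 * X ^ 2 * (8 * X) :=
      mul_le_mul hn (by linarith) (by positivity) (by positivity)
    linarith
  have hC : (r + 1 / t / 2 + ‖w‖) / (r + 1 / t / 2 - ‖w‖) *
      (2 * ValueDistribution.characteristic u ⊤ (r + 1 / t / 2) +
      |Real.log ‖meromorphicTrailingCoeffAt u 0‖| +
      zeroPoleCount u (r + 1 / t / 2) * (4 * (r + 1 / t / 2))) ≤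
      12 * X * (5 * X + 20 * X ^ 2 * (8 * X)) := by
    refine mul_le_mul hratio hB ?_ (by positivity)
    have := ValueDistribution.characteristic_nonneg (f := u) (a := ⊤)
      (show 1 ≤ r + 1 / t / 2 by linarith)
    positivity
  have hp : ∀ k ≤ 6, X ^ k ≤ X ^ 6 := fun k hk => pow_le_pow_right₀ hX1 hk
  have h2 := hp 2 (by norm_num)
  have h3 := hp 3 (by norm_num)
  have h4 := hp 4 (by norm_num)
  nlinarith

/-- If `r` avoids the exceptional neighbourhoods of the moduli of zeros and poles, all zeros and
poles stay away from the circle of radius `r`. -/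
theorem le_norm_sub_of_notMem_near_norms {u : ℂ → ℂ} (hu : Meromorphic u) {r R N : ℝ}
    (hN : zeroPoleCount u R ≤ N)
    (hr : r ∉ ⋃ a ∈ (MeromorphicOn.divisor u Set.univ).support, Metric.ball ‖a‖
      (1 / (((MeromorphicOn.divisor u Set.univ).support ∩
        Metric.closedBall 0 ‖a‖).ncard : ℝ) ^ 2))
    {z : ℂ} (hz : ‖z‖ = r) {a : ℂ} (ha : a ∈ zeroPoleSet u R) : 1 / N ^ 2 ≤ ‖z - a‖ := by
  set S := (MeromorphicOn.divisor u Set.univ).support with hS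
  have ha' := (mem_zeroPoleSet hu).1 ha
  have hsub : S ∩ Metric.closedBall 0 ‖a‖ ⊆ (zeroPoleSet u R : Set ℂ) := by
    rintro x ⟨hxS, hx⟩
    refine (mem_zeroPoleSet hu).2 ⟨?_, hxS⟩
    have : ‖x‖ ≤ ‖a‖ := by simpa using hx
    exact this.trans ha'.1
  have hcard : (((S ∩ Metric.closedBall 0 ‖a‖).ncard : ℕ) : ℝ) ≤ N := by
    have h1 := Set.ncard_le_ncard hsub (Finset.finite_toSet _)
    rw [Set.ncard_coe_finset] at h1
    exact (Nat.cast_le.2 h1).trans ((card_zeroPoleSet_le_zeroPoleCount hu R).trans hN)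
  have hpos : 0 < (S ∩ Metric.closedBall 0 ‖a‖).ncard :=
    (Set.ncard_pos ((Finset.finite_toSet _).subset hsub)).2 ⟨a, ha'.2, by simp⟩
  have hpos' : (0 : ℝ) < (S ∩ Metric.closedBall 0 ‖a‖).ncard := Nat.cast_pos.2 hpos
  have h2 : r ∉ Metric.ball ‖a‖ (1 / ((S ∩ Metric.closedBall 0 ‖a‖).ncard : ℝ) ^ 2) :=
    fun h => hr (Set.mem_biUnion (x := a) ha'.2 h)
  rw [Metric.mem_ball, not_lt, Real.dist_eq, ← hz] at h2
  refine le_trans ?_ (h2.trans (abs_norm_sub_norm_le z a))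
  exact one_div_le_one_div_of_le (by positivity) (pow_le_pow_left₀ hpos'.le hcard 2)

/-- Outside the exceptional radii, a solution of (E) is polynomially bounded on the whole circle in
terms of the radius and the characteristic. -/
theorem exists_posLog_norm_le (b c K s₁ s₂ s₃ : ℂ) (hc : c ≠ 0) :
    ∃ C : ℝ, ∀ (u : ℂ → ℂ), IsMeromorphicSolution b c K s₁ s₂ s₃ u →
      (∀ z, meromorphicOrderAt u z ≠ ⊤) → ∀ r t : ℝ, 1 ≤ r → 1 ≤ t →
      |Real.log ‖meromorphicTrailingCoeffAt u 0‖| ≤ t →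
      ValueDistribution.characteristic u ⊤ (r + 1 / t) ≤ 2 * t →
      (r ∉ ⋃ a ∈ (MeromorphicOn.divisor u Set.univ).support, Metric.ball ‖a‖
        (1 / (((MeromorphicOn.divisor u Set.univ).support ∩
          Metric.closedBall 0 ‖a‖).ncard : ℝ) ^ 2)) →
      ∀ z : ℂ, ‖z‖ = r → Real.posLog ‖u z‖ ≤ C + 72 * Real.log (r * t) := by
  obtain ⟨C, hC1, hC⟩ := exists_norm_le_of_satisfiesE b c K s₁ s₂ s₃ hc
  refine ⟨Real.log C + 4 * Real.log (480000 * 1600 ^ 3), ?_⟩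
  intro u hsol htop r t hr ht ht₀ hT hrE z hz
  have hu := hsol.1.meromorphic
  have ht0 : 0 < t := by linarith
  have hδ : 0 < 1 / t := by positivity
  have hn := zeroPoleCount_le_of_characteristic_le hu hr ht ht₀ hT
  have hlogbound := fun w h1 h2 h3 h4 => abs_log_norm_le_of_characteristic_le hu htop hr ht ht₀ hT
    (w := w) h1 h2 h3 h4
  set X := r * t with hX
  have hXt : t ≤ X := le_mul_of_one_le_left ht0.le hr
  have hX1 : 1 ≤ X := ht.trans hXt
  have hX0 : 0 < X := by linarith
  set η : ℝ := 1 / (800 * X ^ 4) with hη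
  have hη0 : 0 < η := by positivity
  have hηδ : η ≤ 1 / t / 4 := by
    rw [hη, div_div]
    refine one_div_le_one_div_of_le (by positivity) ?_
    have : X ≤ X ^ 4 := le_self_pow₀ hX1 (by norm_num)
    linarith
  have hdist : ∀ w ∈ Metric.ball z η, ∀ a ∈ zeroPoleSet u (r + 1 / t / 2), η ≤ ‖w - a‖ := by
    intro w hw a ha
    have h1 := le_norm_sub_of_notMem_near_norms hu hn hrE hz ha
    have h2 : 1 / (20 * X ^ 2) ^ 2 = 2 * η := by
      rw [hη]
      field_simp
      norm_num
    have h3 : ‖z - w‖ < η := by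
      rw [norm_sub_rev]
      simpa [dist_eq_norm] using hw
    have h4 := norm_sub_le_norm_sub_add_norm_sub z w a
    linarith
  have hwr : ∀ w ∈ Metric.ball z η, ‖w‖ ≤ r + 1 / t / 4 := by
    intro w hw
    have h1 : ‖w - z‖ < η := by simpa [dist_eq_norm] using hw
    linarith [norm_le_norm_add_norm_sub' w z]
  have hgood : ∀ w ∈ Metric.ball z η, AnalyticAt ℂ u w ∧ u w ≠ 0 := by
    intro w hw
    refine hsol.1.analyticAt_and_ne_zero htop ?_
    by_contra h
    have h1 := hdist w hw w ((mem_zeroPoleSet hu).2 ⟨by linarith [hwr w hw], h⟩)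
    simp only [sub_self, norm_zero] at h1
    linarith
  obtain ⟨l, hl, hl0, hexp, hder⟩ := exists_local_log (f := u) (z := z)
    (B := 20000 * X ^ 6) hη0
    (fun w hw => (hgood w hw).1.differentiableAt.differentiableWithinAt)
    (fun w hw => (hgood w hw).2) (by positivity)
    (fun w hw => hlogbound w (hwr w hw) (hgood w hw).1 (hgood w hw).2 (hdist w hw))
  set A : ℝ := 480000 * 1600 ^ 3 * X ^ 18 with hA
  have hA1 : 1 ≤ A := by
    have : 1 ≤ X ^ 18 := one_le_pow₀ hX1
    rw [hA]
    linarith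
  have hderA : ∀ k ≤ 3, ‖iteratedDeriv k l z‖ ≤ A := by
    intro k hk
    refine (hder k).trans ?_
    have h1 : ((k.factorial : ℕ) : ℝ) ≤ 6 := by
      exact_mod_cast (Nat.factorial_le hk)
    have h2 : (1600 * X ^ 4) ^ k ≤ (1600 * X ^ 4) ^ 3 := by
      refine pow_le_pow_right₀ ?_ hk
      have : 1 ≤ X ^ 4 := one_le_pow₀ hX1
      linarith
    have h3 : η / 2 = (1600 * X ^ 4)⁻¹ := by
      rw [hη]
      field_simp
      norm_num
    rw [h3, inv_pow, div_inv_eq_mul]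
    calc (k.factorial : ℝ) * (4 * (20000 * X ^ 6)) * (1600 * X ^ 4) ^ k
        ≤ 6 * (4 * (20000 * X ^ 6)) * (1600 * X ^ 4) ^ 3 := by gcongr
      _ = A := by rw [hA]; ring
  have hzb : z ∈ Metric.ball z η := Metric.mem_ball_self hη0
  have hlogX : 0 ≤ Real.log X := Real.log_nonneg hX1
  have hlogC : 0 ≤ Real.log C := Real.log_nonneg hC1
  have hlogN : (0 : ℝ) ≤ Real.log (480000 * 1600 ^ 3) := Real.log_nonneg (by norm_num)
  rw [Real.posLog]
  refine max_le (by positivity) ?_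
  rcases le_or_gt 1 ‖u z‖ with h1 | h1
  · have h2 := hC u l z A (hsol.2 z (hgood z hzb).1)
      (hl.analyticAt (Metric.ball_mem_nhds z hη0)) hl0
      (by filter_upwards [Metric.ball_mem_nhds z hη0] with w hw using hexp w hw) h1 hA1
      (hderA 1 (by norm_num)) (hderA 2 (by norm_num)) (hderA 3 le_rfl)
    have h3 := Real.log_le_log (by linarith) h2
    rw [Real.log_mul (by positivity) (by positivity), Real.log_pow, hA,
      Real.log_mul (by norm_num) (by positivity), Real.log_pow] at h3
    push_cast at h3
    linarith
  · exact (Real.log_nonpos (norm_nonneg _) h1.le).trans (by positivity)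

/-- Outside a set of finite measure, the proximity function of a transcendental solution of (E) is
bounded by a multiple of `log (r T(r))`. -/
theorem exists_proximity_le {b c K s₁ s₂ s₃ : ℂ} (hc : c ≠ 0) {u : ℂ → ℂ}
    (hu : IsMeromorphicSolution b c K s₁ s₂ s₃ u) (htop : ∀ z, meromorphicOrderAt u z ≠ ⊤)
    (hT : Tendsto (ValueDistribution.characteristic u ⊤) atTop atTop) :
    ∃ (E : Set ℝ) (C : ℝ), MeasurableSet E ∧ volume E < ⊤ ∧ ∀ᶠ r in atTop ⊓ 𝓟 Eᶜ,
      ValueDistribution.proximity u ⊤ r ≤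
        C + 72 * Real.log (r * ValueDistribution.characteristic u ⊤ r) := by
  obtain ⟨C, hC⟩ := exists_posLog_norm_le b c K s₁ s₂ s₃ hc
  have hm := hu.1.meromorphic
  set T := ValueDistribution.characteristic u ⊤ with hTdef
  set c₀ := |Real.log ‖meromorphicTrailingCoeffAt u 0‖| with hc₀
  set S := (MeromorphicOn.divisor u Set.univ).support with hS
  obtain ⟨r₀, hr₀⟩ := (((hT.eventually_ge_atTop (max 1 c₀)).and
    (eventually_ge_atTop 1)).exists_forall_of_atTop)
  have hr₀1 : 1 ≤ r₀ := (hr₀ r₀ le_rfl).2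
  have hmono : MonotoneOn T (Set.Ici r₀) :=
    (ValueDistribution.characteristic_monotoneOn hm).mono fun r hr =>
      lt_of_lt_of_le (by linarith) (Set.mem_Ici.1 hr)
  have hE₀ := volume_borel_exceptional_lt_top hmono
    fun r hr => (le_max_left _ _).trans (hr₀ r hr).1
  set E₀ := {r | r₀ ≤ r ∧ 2 * T r ≤ T (r + 1 / T r)} with hE₀def
  have hSfin : ∀ r : ℝ, (S ∩ Metric.closedBall 0 r).Finite := by
    intro r
    refine (zeroPoleSet u r).finite_toSet.subset ?_
    rintro a ⟨haS, ha⟩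
    exact (mem_zeroPoleSet hm).2 ⟨by simpa using ha, haS⟩
  have hE₁ := volume_near_norms_lt_top hSfin
  set E₁ := ⋃ a ∈ S, Metric.ball ‖a‖ (1 / ((S ∩ Metric.closedBall 0 ‖a‖).ncard : ℝ) ^ 2) with hE₁d
  refine ⟨toMeasurable volume E₀ ∪ E₁, C, (measurableSet_toMeasurable _ _).union
    (isOpen_biUnion fun a _ => Metric.isOpen_ball).measurableSet, ?_, ?_⟩
  · refine (measure_union_le _ _).trans_lt (ENNReal.add_lt_top.2 ⟨?_, hE₁⟩)
    rwa [measure_toMeasurable]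
  · rw [eventually_inf_principal]
    filter_upwards [eventually_ge_atTop r₀] with r hr hrE
    obtain ⟨h1, h2⟩ := hr₀ r hr
    have hrE₀ : r ∉ E₀ := fun h => hrE (Or.inl (subset_toMeasurable _ _ h))
    have hrE₁ : r ∉ E₁ := fun h => hrE (Or.inr h)
    have h3 : T (r + 1 / T r) ≤ 2 * T r := by
      by_contra h
      exact hrE₀ ⟨hr, (not_le.1 h).le⟩
    rw [ValueDistribution.proximity_top]
    refine Real.circleAverage_mono_on_of_le_circle
      hm.meromorphicOn.circleIntegrable_posLog_norm fun z hz => ?_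
    refine hC u hu htop r (T r) h2 ((le_max_left _ _).trans h1) ((le_max_right _ _).trans h1) h3
      hrE₁ z ?_
    rw [abs_of_nonneg (by linarith)] at hz
    simpa using hz

/-- For a transcendental meromorphic solution `u` of (E), `m(r,u) = o(T(r,u))` and
`N(r,u)/T(r,u) → 1` as `r → ∞` outside an exceptional set of finite Lebesgue measure. -/
theorem proximity_small_for_transcendental_solution
    (b c K s₁ s₂ s₃ : ℂ) (hc : c ≠ 0)
    (u : ℂ → ℂ) (hu : IsMeromorphicSolution b c K s₁ s₂ s₃ u)
    (htrans : ¬ IsRationalFunction u) :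
    ∃ E : Set ℝ, MeasurableSet E ∧ volume E < ⊤ ∧
      (proximityFn u) =o[atTop ⊓ 𝓟 Eᶜ] (characteristicFn u) ∧
      Tendsto (fun r => integratedCounting u r / characteristicFn u r)
        (atTop ⊓ 𝓟 Eᶜ) (𝓝 1) := by
  have hm := hu.1.meromorphic
  have htop := meromorphicOrderAt_ne_top_of_not_isRational hu.1 htrans
  have hlog := isLittleO_log_characteristic hu.1 htrans
  set T := ValueDistribution.characteristic u ⊤ with hTdef
  have hT0 : ∀ᶠ r in atTop, 0 ≤ T r := by
    filter_upwards [eventually_ge_atTop 1] with r hr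
      using ValueDistribution.characteristic_nonneg hr
  have hT : Tendsto T atTop atTop := by
    refine tendsto_atTop_mono' _ ?_ Real.tendsto_log_atTop
    filter_upwards [hlog.bound one_pos, hT0] with r hr h0
    rw [one_mul, Real.norm_of_nonneg h0] at hr
    exact (Real.le_norm_self _).trans hr
  obtain ⟨E, C, hE, hvol, hprox⟩ := exists_proximity_le hc hu htop hT
  have hle : atTop ⊓ 𝓟 Eᶜ ≤ atTop := inf_le_left
  have hmaj : (fun r => C + 72 * (Real.log r + Real.log (T r))) =o[atTop] T := by
    refine IsLittleO.add ?_ (IsLittleO.const_mul_left (hlog.add ?_) _)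
    · exact isLittleO_const_left.2 (Or.inr (tendsto_norm_atTop_atTop.comp hT))
    · exact Real.isLittleO_log_id_atTop.comp_tendsto hT
  have hpT : (ValueDistribution.proximity u ⊤) =o[atTop ⊓ 𝓟 Eᶜ] T := by
    refine IsBigO.trans_isLittleO (IsBigO.of_bound 1 ?_) (hmaj.mono hle)
    filter_upwards [hprox, hle (hT.eventually_gt_atTop 0), hle (eventually_gt_atTop 0)]
      with r hr hTr hr0
    rw [Real.log_mul hr0.ne' hTr.ne'] at hr
    rw [one_mul, Real.norm_of_nonneg (ValueDistribution.proximity_nonneg r)]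
    exact hr.trans (Real.le_norm_self _)
  have hchar : characteristicFn u =ᶠ[atTop ⊓ 𝓟 Eᶜ] T := by
    filter_upwards [hle (eventually_ge_atTop 1)] with r hr
      using characteristicFn_eq_characteristic hm htop hr
  have hmo : (proximityFn u) =o[atTop ⊓ 𝓟 Eᶜ] (characteristicFn u) := by
    rw [show proximityFn u = ValueDistribution.proximity u ⊤ from
      funext (proximityFn_eq_proximity u)]
    exact hpT.trans_eventuallyEq hchar.symm
  refine ⟨E, hE, hvol, hmo, ?_⟩
  have hlim := (tendsto_const_nhds (x := (1 : ℝ))).sub hmo.tendsto_div_nhds_zero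
  rw [sub_zero] at hlim
  refine hlim.congr' ?_
  filter_upwards [hchar, hle (hT.eventually_gt_atTop 0)] with r hr hTr
  have h0 : characteristicFn u r ≠ 0 := by
    rw [hr]
    exact hTr.ne'
  rw [one_sub_div h0, characteristicFn, add_sub_cancel_left]

end
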